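/- arXiv:2411.01891 — 16 statements merged into one kernel-verified Lean document; each statement's English description precedes it below -/
import Mathlib

section
/- Let ν > 0 and let a₀ : ℤ → ℂ satisfy ∑_{k∈ℤ} |a₀(k)| < ν/4. Then there exists a family a : [0,∞) → ℤ → ℂ with ∑_{k∈ℤ} sup_{t∈[0,∞)} |a(t)(k)| < ∞ such that for all t ≥ 0 and all k ∈ ℤ, a(t)(k) = e^{-νt} a₀(k) + ∫₀ᵗ e^{-ν(t-s)} ( ∑_{j∈ℤ} a(s)(j) · (-i · sgn(k-j)) · a(s)(k-j) ) ds. (This is the global mild solution, expressed at the level of Fourier coefficients on the circle, of the equation ω̃_t = ω̃ H(ω̃) - ν ω̃, i.e. the gCLM equation with a = 0, σ = 0, for initial data small in the Wiener algebra.) -/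
open MeasureTheory

open scoped ENNReal

/-- The convolution of `f` with `g` after `g` has been multiplied by the Fourier multiplier `m`. -/
noncomputable def multConv (m f g : ℤ → ℂ) (k : ℤ) : ℂ := ∑' j : ℤ, f j * m (k - j) * g (k - j)

theorem tsum_enorm_multConv_le {m : ℤ → ℂ} (hm : ∀ k, ‖m k‖ₑ ≤ 1) (f g : ℤ → ℂ) :
    ∑' k, ‖multConv m f g k‖ₑ ≤ (∑' k, ‖f k‖ₑ) * ∑' k, ‖g k‖ₑ := by
  calc ∑' k, ‖multConv m f g k‖ₑ
      ≤ ∑' k, ∑' j, ‖f j‖ₑ * ‖g (k - j)‖ₑ := by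
        refine ENNReal.tsum_le_tsum fun k => enorm_tsum_le_tsum_enorm.trans ?_
        refine ENNReal.tsum_le_tsum fun j => ?_
        rw [enorm_mul, enorm_mul]
        gcongr
        exact mul_le_of_le_one_right' (hm _)
    _ = ∑' j, ‖f j‖ₑ * ∑' k, ‖g k‖ₑ := by
        rw [ENNReal.tsum_comm]
        refine tsum_congr fun j => ?_
        rw [ENNReal.tsum_mul_left]
        congr 1
        exact (Equiv.subRight j).tsum_eq fun k => ‖g k‖ₑ
    _ = _ := ENNReal.tsum_mul_right

/-- The Taylor coefficients at `0` of the solution of `b' = multConv m b b` with `b 0 = a₀`. -/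
noncomputable def taylorCoeff (m a₀ : ℤ → ℂ) : ℕ → ℤ → ℂ
  | 0 => a₀
  | n + 1 => fun k =>
      (n + 1 : ℂ)⁻¹ * ∑ i : Fin (n + 1),
        multConv m (taylorCoeff m a₀ i) (taylorCoeff m a₀ (n - i)) k
decreasing_by all_goals omega

theorem succ_mul_taylorCoeff_succ (m a₀ : ℤ → ℂ) (n : ℕ) (k : ℤ) :
    (n + 1 : ℂ) * taylorCoeff m a₀ (n + 1) k =
      ∑ p ∈ Finset.HasAntidiagonal.antidiagonal n,
        multConv m (taylorCoeff m a₀ p.1) (taylorCoeff m a₀ p.2) k := by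
  rw [taylorCoeff, mul_inv_cancel_left₀ (by exact_mod_cast n.succ_ne_zero),
    Finset.Nat.sum_antidiagonal_eq_sum_range_succ
      (fun i j => multConv m (taylorCoeff m a₀ i) (taylorCoeff m a₀ j) k),
    Finset.sum_range fun i => multConv m (taylorCoeff m a₀ i) (taylorCoeff m a₀ (n - i)) k]

theorem tsum_enorm_taylorCoeff_le {m : ℤ → ℂ} (hm : ∀ k, ‖m k‖ₑ ≤ 1) (a₀ : ℤ → ℂ) (n : ℕ) :
    ∑' k, ‖taylorCoeff m a₀ n k‖ₑ ≤ (∑' k, ‖a₀ k‖ₑ) ^ (n + 1) := by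
  induction n using Nat.strong_induction_on with
  | _ n ih =>
  cases n with
  | zero => simp [taylorCoeff]
  | succ n =>
    set A := ∑' k, ‖a₀ k‖ₑ
    have h : (n + 1 : ℝ≥0∞) * ∑' k, ‖taylorCoeff m a₀ (n + 1) k‖ₑ ≤ (n + 1) * A ^ (n + 1 + 1) := by
      calc (n + 1 : ℝ≥0∞) * ∑' k, ‖taylorCoeff m a₀ (n + 1) k‖ₑ
          = ∑' k, ‖(n + 1 : ℂ) * taylorCoeff m a₀ (n + 1) k‖ₑ := by
            have hn : ‖(n + 1 : ℂ)‖ₑ = n + 1 := by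
              rw [← ofReal_norm, show ‖(n + 1 : ℂ)‖ = ((n + 1 : ℕ) : ℝ) by
                exact_mod_cast Complex.norm_natCast (n + 1), ENNReal.ofReal_natCast]
              push_cast
              rfl
            simp_rw [enorm_mul, hn]
            rw [ENNReal.tsum_mul_left]
        _ ≤ ∑' k, ∑ p ∈ Finset.HasAntidiagonal.antidiagonal n,
              ‖multConv m (taylorCoeff m a₀ p.1) (taylorCoeff m a₀ p.2) k‖ₑ := by
            refine ENNReal.tsum_le_tsum fun k => ?_
            rw [succ_mul_taylorCoeff_succ]
            exact enorm_sum_le _ _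
        _ = ∑ p ∈ Finset.HasAntidiagonal.antidiagonal n, ∑' k,
              ‖multConv m (taylorCoeff m a₀ p.1) (taylorCoeff m a₀ p.2) k‖ₑ :=
            Summable.tsum_finsetSum fun _ _ => ENNReal.summable
        _ ≤ ∑ p ∈ Finset.HasAntidiagonal.antidiagonal n, A ^ (n + 1 + 1) := by
            refine Finset.sum_le_sum fun p hp => ?_
            have hp' := Finset.HasAntidiagonal.mem_antidiagonal.mp hp
            refine (tsum_enorm_multConv_le hm _ _).trans ?_
            refine (mul_le_mul' (ih p.1 (by omega)) (ih p.2 (by omega))).trans_eq ?_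
            rw [← pow_add]
            congr 1
            omega
        _ = _ := by simp
    rwa [ENNReal.mul_le_mul_iff_right (by simp) (by simp)] at h

/-- Evaluating power series with absolutely summable coefficient families commutes with
`multConv`. -/
theorem hasSum_multConv_powerSeries {m : ℤ → ℂ} (hm : ∀ k, ‖m k‖ₑ ≤ 1) {c : ℕ → ℤ → ℂ} {z : ℂ}
    (hc : ∑' n, ‖z‖ₑ ^ n * ∑' l, ‖c n l‖ₑ ≠ ∞) (k : ℤ) :
    HasSum (fun n =>
        z ^ n * ∑ p ∈ Finset.HasAntidiagonal.antidiagonal n, multConv m (c p.1) (c p.2) k)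
      (multConv m (fun l => ∑' n, z ^ n * c n l) (fun l => ∑' n, z ^ n * c n l) k) := by
  set F : ℤ → ℕ × ℕ → ℂ := fun l p =>
    z ^ p.1 * c p.1 l * (m (k - l) * (z ^ p.2 * c p.2 (k - l))) with hF
  have hF_sum : Summable (Function.uncurry F) := by
    rw [← summable_norm_iff, ← tsum_enorm_ne_top_iff_summable_norm]
    refine ne_top_of_le_ne_top (ENNReal.mul_ne_top hc hc) ?_
    calc ∑' x : ℤ × (ℕ × ℕ), ‖Function.uncurry F x‖ₑ
        = ∑' (p : ℕ × ℕ) (l : ℤ), ‖F l p‖ₑ := by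
          rw [ENNReal.tsum_comm, ← ENNReal.tsum_prod]
          rfl
      _ ≤ ∑' (p : ℕ × ℕ) (l : ℤ),
            ‖z‖ₑ ^ p.1 * ‖c p.1 l‖ₑ * (‖z‖ₑ ^ p.2 * ∑' l, ‖c p.2 l‖ₑ) := by
          refine ENNReal.tsum_le_tsum fun p => ENNReal.tsum_le_tsum fun l => ?_
          simp only [hF, enorm_mul, enorm_pow]
          refine mul_le_mul' le_rfl ((mul_le_of_le_one_left' (hm _)).trans ?_)
          gcongr
          exact ENNReal.le_tsum (f := fun l => ‖c p.2 l‖ₑ) (k - l)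
      _ = ∑' (i : ℕ) (j : ℕ),
            (‖z‖ₑ ^ i * ∑' l, ‖c i l‖ₑ) * (‖z‖ₑ ^ j * ∑' l, ‖c j l‖ₑ) := by
          rw [← ENNReal.tsum_prod (f := fun i j =>
            (‖z‖ₑ ^ i * ∑' l, ‖c i l‖ₑ) * (‖z‖ₑ ^ j * ∑' l, ‖c j l‖ₑ))]
          refine tsum_congr fun p => ?_
          rw [ENNReal.tsum_mul_right, ENNReal.tsum_mul_left]
      _ = _ := by simp_rw [ENNReal.tsum_mul_left, ENNReal.tsum_mul_right]
  have hc_sum (l : ℤ) : Summable fun n => ‖z ^ n * c n l‖ := by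
    rw [← tsum_enorm_ne_top_iff_summable_norm]
    refine ne_top_of_le_ne_top hc (ENNReal.tsum_le_tsum fun n => ?_)
    rw [enorm_mul, enorm_pow]
    gcongr
    exact ENNReal.le_tsum (f := fun l => ‖c n l‖ₑ) l
  have h_pairs : HasSum (fun p : ℕ × ℕ => z ^ (p.1 + p.2) * multConv m (c p.1) (c p.2) k)
      (multConv m (fun l => ∑' n, z ^ n * c n l) (fun l => ∑' n, z ^ n * c n l) k) := by
    have h₁ : multConv m (fun l => ∑' n, z ^ n * c n l) (fun l => ∑' n, z ^ n * c n l) k =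
        ∑' l, ∑' p, F l p := by
      refine tsum_congr fun l => ?_
      rw [mul_assoc, ← tsum_mul_left]
      refine tsum_mul_tsum_of_summable_norm (hc_sum l) ?_
      simp_rw [norm_mul (m _)]
      exact (hc_sum (k - l)).mul_left _
    have h₂ (p : ℕ × ℕ) :
        z ^ (p.1 + p.2) * multConv m (c p.1) (c p.2) k = ∑' l, F l p := by
      rw [multConv, ← tsum_mul_left]
      refine tsum_congr fun l => ?_
      simp only [hF]
      ring
    have h_swap : Summable (Function.uncurry fun p l => F l p) := hF_sum.prod_symm
    simp_rw [h₁, h₂, ← hF_sum.tsum_comm]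
    exact h_swap.prod.hasSum
  convert (Finset.HasAntidiagonal.sigmaAntidiagonalEquivProd.hasSum_iff.mpr h_pairs).sigma
    fun n => hasSum_fintype _ using 2 with n
  rw [Finset.mul_sum, ← Finset.sum_coe_sort]
  refine Finset.sum_congr rfl fun p _ => ?_
  change _ = z ^ (p.1.1 + p.1.2) * _
  rw [Finset.HasAntidiagonal.mem_antidiagonal.mp p.2]
  rfl

theorem hasDerivAt_one_sub_exp_div {ν : ℝ} (hν : ν ≠ 0) (s : ℝ) :
    HasDerivAt (fun s => (1 - Real.exp (-(ν * s))) / ν) (Real.exp (-(ν * s))) s := by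
  have h : HasDerivAt (fun s => -(ν * s)) (-ν) s := by
    simpa using! ((hasDerivAt_id s).const_mul ν).neg
  refine ((h.exp.const_sub 1).div_const ν).congr_deriv ?_
  field_simp

theorem integral_exp_mul_one_sub_exp_div_pow {ν : ℝ} (hν : ν ≠ 0) (n : ℕ) (t : ℝ) :
    ∫ s in (0 : ℝ)..t, Real.exp (-(ν * s)) * ((1 - Real.exp (-(ν * s))) / ν) ^ n =
      ((1 - Real.exp (-(ν * t))) / ν) ^ (n + 1) / (n + 1) := by
  have h (s : ℝ) : HasDerivAt (fun s => ((1 - Real.exp (-(ν * s))) / ν) ^ (n + 1) / (n + 1))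
      (Real.exp (-(ν * s)) * ((1 - Real.exp (-(ν * s))) / ν) ^ n) s := by
    refine (((hasDerivAt_one_sub_exp_div hν s).pow (n + 1)).div_const (n + 1 : ℝ)).congr_deriv ?_
    rw [Nat.add_sub_cancel, Nat.cast_add_one]
    field_simp
  rw [intervalIntegral.integral_eq_sub_of_hasDerivAt (fun s _ => h s)
    (Continuous.intervalIntegrable (by fun_prop) _ _)]
  simp

/-- Termwise integration of a power series in `(1 - exp (-ν s)) / ν`. -/
theorem hasSum_integral_exp_mul_powerSeries {ν : ℝ} (hν : 0 < ν) {d : ℕ → ℂ} {f : ℝ → ℂ}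
    (hd : Summable fun n => (1 / ν) ^ n * ‖d n‖)
    (hf : ∀ s, 0 ≤ s →
      HasSum (fun n => (((1 - Real.exp (-(ν * s))) / ν : ℝ) : ℂ) ^ n * d n) (f s))
    {t : ℝ} (ht : 0 ≤ t) :
    HasSum (fun n => (((1 - Real.exp (-(ν * t))) / ν : ℝ) : ℂ) ^ (n + 1) / (n + 1) * d n)
      (∫ s in (0 : ℝ)..t, (Real.exp (-(ν * s)) : ℂ) * f s) := by
  have h := intervalIntegral.hasSum_integral_of_dominated_convergence (a := 0) (b := t)
    (μ := volume) (f := fun s => (Real.exp (-(ν * s)) : ℂ) * f s)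
    (F := fun n s => (Real.exp (-(ν * s)) : ℂ) *
      ((((1 - Real.exp (-(ν * s))) / ν : ℝ) : ℂ) ^ n * d n))
    (fun n _ => (1 / ν) ^ n * ‖d n‖)
    (fun n => Continuous.aestronglyMeasurable (by fun_prop)) ?_
    (.of_forall fun _ _ => hd) intervalIntegrable_const ?_
  · convert! h using 2 with n
    simp_rw [← mul_assoc, ← Complex.ofReal_pow, ← Complex.ofReal_mul]
    rw [intervalIntegral.integral_mul_const, intervalIntegral.integral_ofReal,
      integral_exp_mul_one_sub_exp_div_pow hν.ne']
    push_cast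
    rfl
  · refine fun n => .of_forall fun s hs => ?_
    rw [Set.uIoc_of_le ht] at hs
    have h₁ : Real.exp (-(ν * s)) ≤ 1 :=
      Real.exp_le_one_iff.mpr (neg_nonpos.mpr (mul_nonneg hν.le hs.1.le))
    have h₂ := Real.exp_pos (-(ν * s))
    have h₃ : 0 ≤ (1 - Real.exp (-(ν * s))) / ν := div_nonneg (by linarith) hν.le
    rw [norm_mul, norm_mul, norm_pow, Complex.norm_real, Complex.norm_real,
      Real.norm_of_nonneg h₂.le, Real.norm_of_nonneg h₃]
    refine (mul_le_of_le_one_left (by positivity) h₁).trans ?_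
    gcongr
    linarith
  · refine .of_forall fun s hs => ?_
    rw [Set.uIoc_of_le ht] at hs
    exact (hf s hs.1.le).mul_left _

theorem multConv_const_mul (m f : ℤ → ℂ) (z : ℂ) (k : ℤ) :
    multConv m (fun l => z * f l) (fun l => z * f l) k = z ^ 2 * multConv m f f k := by
  rw [multConv, multConv, ← tsum_mul_left]
  refine tsum_congr fun l => ?_
  ring

/-- Global existence of a mild solution, at the level of Fourier coefficients on the circle,
of `ω̃_t = ω̃ H(ω̃) - ν ω̃` (the gCLM equation with `a = 0`, `σ = 0`) for initial data
that is small in the Wiener algebra. -/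
theorem gclm_global_mild_solution_a0_sigma0
    (ν : ℝ) (hν : 0 < ν) (a₀ : ℤ → ℂ)
    (hsum : Summable fun k : ℤ => ‖a₀ k‖)
    (hsmall : (∑' k : ℤ, ‖a₀ k‖) < ν / 4) :
    ∃ a : ℝ → ℤ → ℂ,
      (∃ M : ℤ → ℝ, Summable M ∧ ∀ k : ℤ, ∀ t : ℝ, 0 ≤ t → ‖a t k‖ ≤ M k) ∧
      ∀ t : ℝ, 0 ≤ t → ∀ k : ℤ,
        a t k = (Real.exp (-(ν * t)) : ℂ) * a₀ k +
          ∫ s in (0:ℝ)..t, (Real.exp (-(ν * (t - s))) : ℂ) *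
            (∑' j : ℤ, a s j * (-Complex.I * ((k - j).sign : ℂ)) * a s (k - j)) := by
  set m : ℤ → ℂ := fun k => -Complex.I * (k.sign : ℂ) with hm_def
  have hm (k : ℤ) : ‖m k‖ₑ ≤ 1 := by
    rw [← ofReal_norm, ENNReal.ofReal_le_one]
    rcases lt_trichotomy k 0 with h | h | h <;>
      simp [hm_def, h, Int.sign_eq_neg_one_of_neg, Int.sign_eq_one_of_pos]
  set c := taylorCoeff m a₀ with hc_def
  set τ : ℝ → ℝ := fun s => (1 - Real.exp (-(ν * s))) / ν
  set R : ℝ≥0∞ := ENNReal.ofReal (1 / ν) with hR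
  have hc_total : ∑' n, R ^ n * ∑' l, ‖c n l‖ₑ ≠ ∞ := by
    set A := ∑' k, ‖a₀ k‖ₑ with hA_def
    have hA : A = ENNReal.ofReal (∑' k, ‖a₀ k‖) := by
      rw [ENNReal.ofReal_tsum_of_nonneg (fun _ => norm_nonneg _) hsum]
      simp_rw [ofReal_norm, hA_def]
    have hRA : R * A < 1 := by
      rw [hA, hR, ← ENNReal.ofReal_mul (by positivity), ENNReal.ofReal_lt_one, one_div_mul_eq_div,
        div_lt_one hν]
      linarith
    have h_le : ∑' n, R ^ n * ∑' l, ‖c n l‖ₑ ≤ (1 - R * A)⁻¹ * A := by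
      rw [← ENNReal.tsum_geometric, ← ENNReal.tsum_mul_right]
      refine ENNReal.tsum_le_tsum fun n => ?_
      rw [mul_pow, mul_assoc, ← pow_succ]
      gcongr
      exact tsum_enorm_taylorCoeff_le hm a₀ n
    refine ne_top_of_le_ne_top (ENNReal.mul_ne_top ?_ (hA ▸ ENNReal.ofReal_ne_top)) h_le
    exact ENNReal.inv_ne_top.mpr (tsub_pos_of_lt hRA).ne'
  have hτ {s : ℝ} (hs : 0 ≤ s) : ‖(τ s : ℂ)‖ₑ ≤ R := by
    have h₁ : Real.exp (-(ν * s)) ≤ 1 :=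
      Real.exp_le_one_iff.mpr (neg_nonpos.mpr (mul_nonneg hν.le hs))
    have h₂ := Real.exp_pos (-(ν * s))
    have h₃ : 0 ≤ τ s := div_nonneg (by linarith) hν.le
    rw [← ofReal_norm, Complex.norm_real, Real.norm_of_nonneg h₃]
    refine ENNReal.ofReal_le_ofReal (div_le_div_of_nonneg_right ?_ hν.le)
    linarith
  have hc_point {z : ℂ} (hz : ‖z‖ₑ ≤ R) : ∑' n, ‖z‖ₑ ^ n * ∑' l, ‖c n l‖ₑ ≠ ∞ :=
    ne_top_of_le_ne_top hc_total (ENNReal.tsum_le_tsum fun n => by gcongr)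
  set b : ℂ → ℤ → ℂ := fun z l => ∑' n, z ^ n * c n l
  have hb_conv {z : ℂ} (hz : ‖z‖ₑ ≤ R) (k : ℤ) :
      HasSum (fun n : ℕ => z ^ n * ((n + 1 : ℂ) * c (n + 1) k)) (multConv m (b z) (b z) k) := by
    simp_rw [hc_def, succ_mul_taylorCoeff_succ]
    exact hasSum_multConv_powerSeries hm (hc_point hz) k
  set M : ℤ → ℝ≥0∞ := fun l => ∑' n, R ^ n * ‖c n l‖ₑ with hM
  have hM_total : ∑' l, M l ≠ ∞ := by
    rw [hM, ENNReal.tsum_comm]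
    simpa only [ENNReal.tsum_mul_left] using hc_total
  have hM_ne (l : ℤ) : M l ≠ ∞ := ENNReal.ne_top_of_tsum_ne_top hM_total l
  have hb_enorm {z : ℂ} (hz : ‖z‖ₑ ≤ R) (l : ℤ) : ∑' n, ‖z ^ n * c n l‖ₑ ≤ M l := by
    refine ENNReal.tsum_le_tsum fun n => ?_
    rw [enorm_mul, enorm_pow]
    gcongr
  refine ⟨fun t k => (Real.exp (-(ν * t)) : ℂ) * b (τ t) k,
    ⟨fun l => (M l).toReal, ENNReal.summable_toReal hM_total, fun k t ht => ?_⟩, fun t ht k => ?_⟩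
  · have h₁ : Real.exp (-(ν * t)) ≤ 1 :=
      Real.exp_le_one_iff.mpr (neg_nonpos.mpr (mul_nonneg hν.le ht))
    rw [norm_mul, Complex.norm_real, Real.norm_of_nonneg (Real.exp_pos _).le]
    refine (mul_le_of_le_one_left (norm_nonneg _) h₁).trans ?_
    rw [← toReal_enorm]
    exact ENNReal.toReal_mono (hM_ne k)
      (enorm_tsum_le_tsum_enorm.trans (hb_enorm (hτ ht) k))
  · have hd : Summable fun n : ℕ => (1 / ν) ^ n * ‖(n + 1 : ℂ) * c (n + 1) k‖ := by
      have hz : ‖((1 / ν : ℝ) : ℂ)‖ₑ ≤ R := by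
        rw [← ofReal_norm, Complex.norm_real, Real.norm_of_nonneg (by positivity)]
      convert (hb_conv hz k).summable.norm using 2 with n
      rw [norm_mul (_ ^ n), norm_pow, Complex.norm_real, Real.norm_of_nonneg (by positivity)]
    have h_int := hasSum_integral_exp_mul_powerSeries hν hd (fun s hs => hb_conv (hτ hs) k) ht
    have h_series : Summable fun n => (τ t : ℂ) ^ n * c n k := by
      rw [← summable_norm_iff, ← tsum_enorm_ne_top_iff_summable_norm]
      exact ne_top_of_le_ne_top (hM_ne k) (hb_enorm (hτ ht) k)
    have h_b : b (τ t) k =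
        a₀ k + ∫ s in (0 : ℝ)..t, (Real.exp (-(ν * s)) : ℂ) * multConv m (b (τ s)) (b (τ s)) k := by
      rw [← h_int.tsum_eq]
      refine h_series.tsum_eq_zero_add.trans ?_
      congr 1
      · simp [hc_def, taylorCoeff]
      · refine tsum_congr fun n => ?_
        have : (n + 1 : ℂ) ≠ 0 := by exact_mod_cast n.succ_ne_zero
        rw [← mul_assoc, div_mul_cancel₀ _ this]
    beta_reduce
    rw [h_b, mul_add, ← intervalIntegral.integral_const_mul]
    congr 1
    refine intervalIntegral.integral_congr fun s _ => ?_
    have h_exp : (Real.exp (-(ν * t)) : ℂ) * Real.exp (-(ν * s)) =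
        Real.exp (-(ν * (t - s))) * (Real.exp (-(ν * s)) : ℂ) ^ 2 := by
      rw [← Complex.ofReal_pow, ← Complex.ofReal_mul, ← Complex.ofReal_mul, ← Real.exp_nat_mul,
        ← Real.exp_add, ← Real.exp_add]
      congr 2
      push_cast
      ring
    rw [← mul_assoc, h_exp, mul_assoc, ← multConv_const_mul]
    rfl
end

section
/- Let ν > 0, σ > 0, let ω_av ∈ ℝ, and let a₀ : ℤ → ℂ satisfy a₀(0) = 0 and ∑_{k∈ℤ} |a₀(k)| < ν/4. Then there exists a family a : [0,∞) → ℤ → ℂ with a(t)(0) = 0 for all t and ∑_{k∈ℤ} sup_{t∈[0,∞)} |a(t)(k)| < ∞ such that for all t ≥ 0 and all k ∈ ℤ with k ≠ 0, a(t)(k) = e^{-ν|k|^σ t} a₀(k) + ∫₀ᵗ e^{-ν|k|^σ (t-s)} ( ∑_{j∈ℤ} a(s)(j) · (-i · sgn(k-j)) · a(s)(k-j) + ω_av · (-i · sgn(k)) · a(s)(k) ) ds. (This is a global mild solution, at the level of Fourier coefficients on the circle, of ω̃_t = ω̃H(ω̃) - νΛ^σ ω̃ with a = 0, where ω̃ =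 ω + ω_av and ω has zero mean and small Wiener norm.) -/
open scoped BoundedContinuousFunction

/-- A quadratic equation `x = e + B x x` with small data in a Banach space has a solution. -/
theorem exists_eq_add_bilinear {X : Type*} [NormedAddCommGroup X] [NormedSpace ℂ X]
    [CompleteSpace X] (B : X →ₗ[ℂ] X →ₗ[ℂ] X) {c : ℝ} (hc : 0 < c)
    (hB : ∀ x y, ‖B x y‖ ≤ c * (‖x‖ * ‖y‖)) (e : X) (he : 4 * c * ‖e‖ < 1) :
    ∃ x, x = e + B x x := by
  set R := 2 * ‖e‖ with hR
  have hR0 : 0 ≤ R := by positivity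
  have hmaps : Set.MapsTo (fun x => e + B x x) (Metric.closedBall 0 R) (Metric.closedBall 0 R) := by
    intro x hx
    rw [mem_closedBall_zero_iff] at hx ⊢
    have h1 := norm_add_le e (B x x)
    have h2 := hB x x
    have h3 : ‖x‖ * ‖x‖ ≤ R * R := by gcongr
    have h4 : c * (‖x‖ * ‖x‖) ≤ c * (R * R) := by gcongr
    have h5 : 4 * c * ‖e‖ * ‖e‖ ≤ 1 * ‖e‖ := by gcongr
    change ‖e + B x x‖ ≤ R
    have h6 : c * (R * R) = 4 * c * ‖e‖ * ‖e‖ := by rw [hR]; ring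
    linarith
  have hK0 : 0 ≤ 2 * c * R := by positivity
  have hcontr : ContractingWith (2 * c * R).toNNReal (hmaps.restrict _ _ _) := by
    refine ⟨?_, LipschitzWith.of_dist_le_mul ?_⟩
    · rw [Real.toNNReal_lt_one, hR]
      linarith
    · rintro ⟨x, hx⟩ ⟨y, hy⟩
      rw [mem_closedBall_zero_iff] at hx hy
      rw [Real.coe_toNNReal _ hK0, Subtype.dist_eq, Subtype.dist_eq, dist_eq_norm, dist_eq_norm]
      change ‖e + B x x - (e + B y y)‖ ≤ 2 * c * R * ‖x - y‖
      have h1 : e + B x x - (e + B y y) = B x (x - y) + B (x - y) y := by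
        simp only [map_sub, LinearMap.sub_apply]
        abel
      rw [h1]
      calc ‖B x (x - y) + B (x - y) y‖
          ≤ c * (‖x‖ * ‖x - y‖) + c * (‖x - y‖ * ‖y‖) :=
            (norm_add_le _ _).trans (add_le_add (hB _ _) (hB _ _))
        _ ≤ c * (R * ‖x - y‖) + c * (‖x - y‖ * R) := by gcongr
        _ = 2 * c * R * ‖x - y‖ := by ring
  obtain ⟨x, -, hx, -⟩ := hcontr.exists_fixedPoint' Metric.isClosed_closedBall.isComplete hmaps
    (x := 0) (Metric.mem_closedBall_self hR0) (edist_ne_top _ _)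
  exact ⟨x, hx.symm⟩

section Convolution

variable {A : Type*} [NormedRing A]

/-- The pairs `(k, j)` are reindexed as the pairs `(j, k - j)` of a convolution on `ℤ`. -/
def convolutionEquiv : ℤ × ℤ ≃ ℤ × ℤ where
  toFun p := (p.2, p.1 - p.2)
  invFun q := (q.1 + q.2, q.1)
  left_inv p := by ext <;> simp
  right_inv q := by ext <;> simp

variable {x y : ℤ → A}

theorem summable_norm_convolution_prod (hx : Summable fun k => ‖x k‖)
    (hy : Summable fun k => ‖y k‖) :
    Summable fun p : ℤ × ℤ => ‖x p.2‖ * ‖y (p.1 - p.2)‖ :=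
  convolutionEquiv.summable_iff.mpr
    (hx.mul_of_nonneg hy (fun _ => norm_nonneg _) fun _ => norm_nonneg _)

theorem tsum_norm_convolution_prod (hx : Summable fun k => ‖x k‖)
    (hy : Summable fun k => ‖y k‖) :
    ∑' k, ∑' j, ‖x j‖ * ‖y (k - j)‖ = (∑' k, ‖x k‖) * ∑' k, ‖y k‖ := by
  have h := hx.mul_of_nonneg hy (fun _ => norm_nonneg _) fun _ => norm_nonneg _
  rw [hx.tsum_mul_tsum hy h, ← convolutionEquiv.tsum_eq]
  exact ((summable_norm_convolution_prod hx hy).tsum_prod).symm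

theorem memℓp_one_iff {x : ℤ → A} : Memℓp x 1 ↔ Summable fun k => ‖x k‖ := by
  rw [memℓp_gen_iff (by simp)]
  simp

theorem lp_one_norm_eq (x : lp (fun _ : ℤ => A) 1) : ‖x‖ = ∑' k, ‖x k‖ := by
  rw [lp.norm_eq_tsum_rpow (by simp)]
  simp

theorem lp_one_summable (x : lp (fun _ : ℤ => A) 1) : Summable fun k => ‖x k‖ :=
  memℓp_one_iff.mp x.2

variable [NormedAlgebra ℂ A] {m : ℤ → ℂ}

theorem norm_mul_smul_le {r : ℂ} (hr : ‖r‖ ≤ 1) (a b : A) : ‖a * (r • b)‖ ≤ ‖a‖ * ‖b‖ := by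
  refine (norm_mul_le _ _).trans ?_
  gcongr
  rw [norm_smul]
  exact mul_le_of_le_one_left (norm_nonneg _) hr

theorem summable_norm_mul_smul (hm : ∀ k, ‖m k‖ ≤ 1) (hx : Summable fun k => ‖x k‖)
    (hy : Summable fun k => ‖y k‖) (k : ℤ) :
    Summable fun j => ‖x j * (m (k - j) • y (k - j))‖ :=
  .of_nonneg_of_le (fun _ => norm_nonneg _) (fun j => norm_mul_smul_le (hm (k - j)) _ _)
    ((summable_norm_convolution_prod hx hy).prod_factor k)

theorem norm_tsum_mul_smul_le (hm : ∀ k, ‖m k‖ ≤ 1) (hx : Summable fun k => ‖x k‖)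
    (hy : Summable fun k => ‖y k‖) (k : ℤ) :
    ‖∑' j, x j * (m (k - j) • y (k - j))‖ ≤ ∑' j, ‖x j‖ * ‖y (k - j)‖ :=
  (norm_tsum_le_tsum_norm (summable_norm_mul_smul hm hx hy k)).trans
    ((summable_norm_mul_smul hm hx hy k).tsum_le_tsum (fun j => norm_mul_smul_le (hm (k - j)) _ _)
      ((summable_norm_convolution_prod hx hy).prod_factor k))

/-- Solvability in `ℓ¹(ℤ; A)` of a small-data quadratic equation whose nonlinearity is a
convolution with a bounded multiplier, followed by bounded operators acting modewise. -/
theorem exists_summable_eq_add_convolution [CompleteSpace A] (hm : ∀ k, ‖m k‖ ≤ 1)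
    (D : ℤ → A →L[ℂ] A) {c : ℝ} (hc : 0 < c) (hD : ∀ k f, ‖D k f‖ ≤ c * ‖f‖) (e : ℤ → A)
    (he : Summable fun k => ‖e k‖) (hsmall : 4 * c * ∑' k, ‖e k‖ < 1) :
    ∃ x : ℤ → A, (Summable fun k => ‖x k‖) ∧
      ∀ k, x k = e k + D k (∑' j, x j * (m (k - j) • x (k - j))) := by
  let q (x y : ℤ → A) (k : ℤ) : A := D k (∑' j, x j * (m (k - j) • y (k - j)))
  have hqle (x y : lp (fun _ : ℤ => A) 1) (k : ℤ) :
      ‖q x y k‖ ≤ c * ∑' j, ‖x j‖ * ‖y (k - j)‖ :=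
    (hD k _).trans (mul_le_mul_of_nonneg_left
      (norm_tsum_mul_smul_le hm (lp_one_summable x) (lp_one_summable y) k) hc.le)
  have hsum (x y : lp (fun _ : ℤ => A) 1) :
      Summable fun k => c * ∑' j, ‖x j‖ * ‖y (k - j)‖ :=
    (summable_norm_convolution_prod (lp_one_summable x) (lp_one_summable y)).prod.mul_left c
  have hq (x y : lp (fun _ : ℤ => A) 1) : Memℓp (q x y) 1 :=
    memℓp_one_iff.mpr (.of_nonneg_of_le (fun _ => norm_nonneg _) (hqle x y) (hsum x y))
  have hs (x y : lp (fun _ : ℤ => A) 1) (k : ℤ) :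
      Summable fun j => x j * (m (k - j) • y (k - j)) :=
    (summable_norm_mul_smul hm (lp_one_summable x) (lp_one_summable y) k).of_norm
  let B : lp (fun _ : ℤ => A) 1 →ₗ[ℂ] lp (fun _ : ℤ => A) 1 →ₗ[ℂ] lp (fun _ : ℤ => A) 1 :=
    LinearMap.mk₂ ℂ (fun x y => ⟨q x y, hq x y⟩)
      (fun x x' y => by
        ext k
        change D k _ = D k _ + D k _
        rw [← map_add, ← (hs x y k).tsum_add (hs x' y k)]
        simp [add_mul])
      (fun r x y => by
        ext k
        change D k _ = r • D k _
        rw [← map_smul, ← (hs x y k).tsum_const_smul]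
        simp only [lp.coeFn_smul, Pi.smul_apply, smul_mul_assoc])
      (fun x y y' => by
        ext k
        change D k _ = D k _ + D k _
        rw [← map_add, ← (hs x y k).tsum_add (hs x y' k)]
        simp [mul_add])
      (fun r x y => by
        ext k
        change D k _ = r • D k _
        rw [← map_smul, ← (hs x y k).tsum_const_smul]
        refine congrArg (D k) (tsum_congr fun j => ?_)
        rw [lp.coeFn_smul, Pi.smul_apply, smul_comm, mul_smul_comm])
  have hB (x y) : ‖B x y‖ ≤ c * (‖x‖ * ‖y‖) := by
    rw [lp_one_norm_eq, lp_one_norm_eq, lp_one_norm_eq,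
      ← tsum_norm_convolution_prod (lp_one_summable x) (lp_one_summable y), ← tsum_mul_left]
    exact (lp_one_summable (B x y)).tsum_le_tsum (hqle x y) (hsum x y)
  obtain ⟨x, hx⟩ := exists_eq_add_bilinear B hc hB ⟨e, memℓp_one_iff.mpr he⟩
    (by rw [lp_one_norm_eq]; exact hsmall)
  exact ⟨x, lp_one_summable x, fun k => congrArg (fun z : lp (fun _ : ℤ => A) 1 => z k) hx⟩

end Convolution

section Duhamel

variable {ν : ℝ} {z : ℂ}

theorem integral_exp_mul_sub_le (hν : 0 < ν) (t : ℝ) :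
    ∫ s in (0 : ℝ)..t, Real.exp (-(ν * (t - s))) ≤ ν⁻¹ := by
  have h (s : ℝ) : HasDerivAt (fun s => ν⁻¹ * Real.exp (-(ν * (t - s))))
      (Real.exp (-(ν * (t - s)))) s := by
    have h1 : HasDerivAt (fun s => -(ν * (t - s))) ν s := by
      exact (((hasDerivAt_id s).const_sub t).const_mul ν).neg.congr_deriv (by ring)
    exact (h1.exp.const_mul ν⁻¹).congr_deriv (by field_simp)
  rw [intervalIntegral.integral_eq_sub_of_hasDerivAt (fun s _ => h s)
    (Continuous.intervalIntegrable (by fun_prop) _ _)]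
  have : 0 ≤ ν⁻¹ * Real.exp (-(ν * (t - 0))) := by positivity
  simpa using this

theorem norm_duhamel_le (hν : 0 < ν) (hz : ν ≤ z.re) (f : ℝ →ᵇ ℂ) {t : ℝ} (ht : 0 ≤ t) :
    ‖∫ s in (0 : ℝ)..t, Complex.exp (-z * (t - s)) * f s‖ ≤ ν⁻¹ * ‖f‖ := by
  calc ‖∫ s in (0 : ℝ)..t, Complex.exp (-z * (t - s)) * f s‖
      ≤ ∫ s in (0 : ℝ)..t, Real.exp (-(ν * (t - s))) * ‖f‖ := by
        refine intervalIntegral.norm_integral_le_of_norm_le ht (.of_forall fun s hs => ?_)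
          (Continuous.intervalIntegrable (by fun_prop) _ _)
        rw [norm_mul, Complex.norm_exp]
        gcongr
        · have : (-z * ((t : ℂ) - s)).re = -(z.re * (t - s)) := by
            simp [← Complex.ofReal_sub]
          rw [this]
          have := sub_nonneg.mpr hs.2
          gcongr
        · exact f.norm_coe_le_norm s
    _ ≤ ν⁻¹ * ‖f‖ := by
        rw [intervalIntegral.integral_mul_const]
        gcongr
        exact integral_exp_mul_sub_le hν t

theorem duhamel_eq_exp_mul (z : ℂ) (f : ℝ → ℂ) (t : ℝ) :
    ∫ s in (0 : ℝ)..t, Complex.exp (-z * (t - s)) * f s =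
      Complex.exp (-z * t) * ∫ s in (0 : ℝ)..t, Complex.exp (z * s) * f s := by
  rw [← intervalIntegral.integral_const_mul]
  refine intervalIntegral.integral_congr fun s _ => ?_
  change _ = Complex.exp (-z * t) * (Complex.exp (z * s) * f s)
  rw [← mul_assoc, ← Complex.exp_add]
  ring_nf

theorem hasDerivAt_exp_mul_ofReal (z : ℂ) (t : ℝ) :
    HasDerivAt (fun s : ℝ => Complex.exp (z * s)) (z * Complex.exp (z * t)) t := by
  have h := ((hasDerivAt_id t).ofReal_comp.const_mul z).cexp
  simpa [mul_comm] using h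

theorem continuous_integral_exp_mul (z : ℂ) {f : ℝ → ℂ} (hf : Continuous f) :
    Continuous fun t : ℝ => ∫ s in (0 : ℝ)..t, Complex.exp (z * s) * f s :=
  intervalIntegral.continuous_primitive
    (fun _ _ => Continuous.intervalIntegrable (by fun_prop) _ _) 0

/-- The Duhamel operator of the decaying exponential `exp (-z t)` on bounded functions, extended
to negative times by its value at time zero. -/
noncomputable def duhamel (hν : 0 < ν) (hz : ν ≤ z.re) : (ℝ →ᵇ ℂ) →L[ℂ] (ℝ →ᵇ ℂ) :=
  LinearMap.mkContinuous
    { toFun f := .ofNormedAddCommGroup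
        (fun t => ∫ s in (0 : ℝ)..max t 0, Complex.exp (-z * ((max t 0 : ℝ) - s)) * f s)
        (by
          simp only [duhamel_eq_exp_mul]
          have := (continuous_integral_exp_mul z f.continuous).comp
            (continuous_id.max continuous_const : Continuous fun t : ℝ => max t 0)
          exact Continuous.mul (by fun_prop) this)
        (ν⁻¹ * ‖f‖) (fun t => norm_duhamel_le hν hz f (le_max_right _ _))
      map_add' f g := by
        ext t
        simp only [BoundedContinuousFunction.coe_ofNormedAddCommGroup,
          BoundedContinuousFunction.add_apply, mul_add]
        exact intervalIntegral.integral_add (Continuous.intervalIntegrable (by fun_prop) _ _)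
          (Continuous.intervalIntegrable (by fun_prop) _ _)
      map_smul' r f := by
        ext t
        simp [mul_left_comm _ r] }
    ν⁻¹ fun f => (BoundedContinuousFunction.norm_le (by positivity)).mpr fun t =>
      norm_duhamel_le hν hz f (le_max_right _ _)

theorem norm_duhamel_apply_le (hν : 0 < ν) (hz : ν ≤ z.re) (f : ℝ →ᵇ ℂ) :
    ‖duhamel hν hz f‖ ≤ ν⁻¹ * ‖f‖ :=
  (BoundedContinuousFunction.norm_le (by positivity)).mpr fun _ =>
    norm_duhamel_le hν hz f (le_max_right _ _)

theorem duhamel_apply (hν : 0 < ν) (hz : ν ≤ z.re) (f : ℝ →ᵇ ℂ) {t : ℝ} (ht : 0 ≤ t) :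
    duhamel hν hz f t = ∫ s in (0 : ℝ)..t, Complex.exp (-z * (t - s)) * f s := by
  change ∫ s in (0 : ℝ)..max t 0, Complex.exp (-z * ((max t 0 : ℝ) - s)) * f s = _
  rw [max_eq_left ht]

/-- The free evolution `exp (-z t) b` for `t ≥ 0`, extended by `b` to negative times. -/
noncomputable def freeEvolution (hz : 0 ≤ z.re) (b : ℂ) : ℝ →ᵇ ℂ :=
  .ofNormedAddCommGroup (fun t => Complex.exp (-z * (max t 0 : ℝ)) * b) (by fun_prop) ‖b‖
    fun t => by
      rw [norm_mul, Complex.norm_exp]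
      refine mul_le_of_le_one_left (norm_nonneg _) (Real.exp_le_one_iff.mpr ?_)
      have : 0 ≤ z.re * max t 0 := mul_nonneg hz (le_max_right _ _)
      simpa only [Complex.re_mul_ofReal, Complex.neg_re, neg_mul, Left.neg_nonpos_iff] using this

theorem norm_freeEvolution_le (hz : 0 ≤ z.re) (b : ℂ) : ‖freeEvolution hz b‖ ≤ ‖b‖ :=
  BoundedContinuousFunction.norm_ofNormedAddCommGroup_le _ (norm_nonneg _) _

theorem freeEvolution_apply (hz : 0 ≤ z.re) (b : ℂ) {t : ℝ} (ht : 0 ≤ t) :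
    freeEvolution hz b t = Complex.exp (-z * t) * b := by
  change Complex.exp (-z * (max t 0 : ℝ)) * b = _
  rw [max_eq_left ht]

/-- In the Duhamel formula a multiple of the solution may be moved from the exponent into the
forcing. -/
theorem duhamel_change_exponent (z w b : ℂ) {f g : ℝ → ℂ} (hf : Continuous f)
    (hg : ∀ t, 0 ≤ t → g t = Complex.exp (-z * t) * b +
      ∫ s in (0 : ℝ)..t, Complex.exp (-z * (t - s)) * f s) {t : ℝ} (ht : 0 ≤ t) :
    g t = Complex.exp (-w * t) * b +
      ∫ s in (0 : ℝ)..t, Complex.exp (-w * (t - s)) * (f s + (w - z) * g s) := by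
  let F (t : ℝ) : ℂ := b + ∫ s in (0 : ℝ)..t, Complex.exp (z * s) * f s
  have hgF (t : ℝ) (ht : 0 ≤ t) : g t = Complex.exp (-z * t) * F t := by
    rw [hg t ht, duhamel_eq_exp_mul, mul_add]
  have hFc : Continuous F := continuous_const.add (continuous_integral_exp_mul z hf)
  have hF (t : ℝ) : HasDerivAt F (Complex.exp (z * t) * f t) t :=
    ((by fun_prop : Continuous fun s : ℝ => Complex.exp (z * s) * f s).integral_hasStrictDerivAt
      0 t).hasDerivAt.const_add b
  have hG (t : ℝ) : HasDerivAt (fun t : ℝ => Complex.exp ((w - z) * t) * F t)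
      (Complex.exp (w * t) * (f t + (w - z) * (Complex.exp (-z * t) * F t))) t := by
    refine ((hasDerivAt_exp_mul_ofReal (w - z) t).mul (hF t)).congr_deriv ?_
    have h1 : Complex.exp (w * t) = Complex.exp ((w - z) * t) * Complex.exp (z * t) := by
      rw [← Complex.exp_add]; ring_nf
    have h2 : Complex.exp (z * t) * Complex.exp (-z * t) = 1 := by
      rw [← Complex.exp_add]; simp
    rw [h1]
    linear_combination -(Complex.exp ((w - z) * t) * (w - z) * F t) * h2
  have hint : ∫ s in (0 : ℝ)..t, Complex.exp (w * s) * (f s + (w - z) * g s) =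
      Complex.exp ((w - z) * t) * F t - b := by
    calc _ = ∫ s in (0 : ℝ)..t,
          Complex.exp (w * s) * (f s + (w - z) * (Complex.exp (-z * s) * F s)) := by
          refine intervalIntegral.integral_congr fun s hs => ?_
          rw [Set.uIcc_of_le ht] at hs
          simp only [hgF s hs.1]
      _ = _ := by
          rw [intervalIntegral.integral_eq_sub_of_hasDerivAt (fun s _ => hG s)
            (Continuous.intervalIntegrable (by fun_prop) _ _)]
          simp [F]
  rw [duhamel_eq_exp_mul, hint, hgF t ht, mul_sub, ← mul_assoc, ← Complex.exp_add]
  ring_nf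

end Duhamel


open MeasureTheory

/-- Global existence of a mild solution, at the level of Fourier coefficients on the circle,
of `ω̃_t = ω̃ H(ω̃) - ν Λ^σ ω̃` with `a = 0`, `σ > 0`, where `ω̃ = ω + ω_av`, `ω` has zero mean
and data small in the Wiener algebra. -/
theorem gclm_global_mild_solution_a0_sigma_pos
    (ν σ : ℝ) (hν : 0 < ν) (hσ : 0 < σ) (ωav : ℝ) (a₀ : ℤ → ℂ)
    (hzero : a₀ 0 = 0)
    (hsum : Summable fun k : ℤ => ‖a₀ k‖)
    (hsmall : (∑' k : ℤ, ‖a₀ k‖) < ν / 4) :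
    ∃ a : ℝ → ℤ → ℂ,
      (∀ t : ℝ, 0 ≤ t → a t 0 = 0) ∧
      (∃ M : ℤ → ℝ, Summable M ∧ ∀ k : ℤ, ∀ t : ℝ, 0 ≤ t → ‖a t k‖ ≤ M k) ∧
      ∀ t : ℝ, 0 ≤ t → ∀ k : ℤ, k ≠ 0 →
        a t k = (Real.exp (-(ν * |(k : ℝ)| ^ σ * t)) : ℂ) * a₀ k +
          ∫ s in (0:ℝ)..t, (Real.exp (-(ν * |(k : ℝ)| ^ σ * (t - s))) : ℂ) *
            ((∑' j : ℤ, a s j * (-Complex.I * ((k - j).sign : ℂ)) * a s (k - j)) +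
              (ωav : ℂ) * (-Complex.I * (k.sign : ℂ)) * a s k) := by
  let z (k : ℤ) : ℂ := (ν * |(k : ℝ)| ^ σ : ℝ) + Complex.I * (k.sign * ωav)
  let m (k : ℤ) : ℂ := -Complex.I * (k.sign : ℂ)
  have hz (k : ℤ) (hk : k ≠ 0) : ν ≤ (z k).re := by
    have h1 : (1 : ℝ) ≤ |(k : ℝ)| := by exact_mod_cast Int.one_le_abs hk
    have h2 : (1 : ℝ) ≤ |(k : ℝ)| ^ σ := Real.one_le_rpow h1 hσ.le
    have h3 : (z k).re = ν * |(k : ℝ)| ^ σ := by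
      simp only [z, Complex.add_re, Complex.ofReal_re, Complex.I_mul_re]
      simp
    rw [h3]
    exact le_mul_of_one_le_right hν.le h2
  have hm (k : ℤ) : ‖m k‖ ≤ 1 := by
    rcases lt_trichotomy k 0 with h | h | h
    · simp [m, Int.sign_eq_neg_one_of_neg h]
    · simp [m, h]
    · simp [m, Int.sign_eq_one_of_pos h]
  let D (k : ℤ) : (ℝ →ᵇ ℂ) →L[ℂ] (ℝ →ᵇ ℂ) := if hk : k = 0 then 0 else duhamel hν (hz k hk)
  let e (k : ℤ) : ℝ →ᵇ ℂ := if hk : k = 0 then 0 else freeEvolution (hν.le.trans (hz k hk)) (a₀ k)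
  have hD (k : ℤ) (f : ℝ →ᵇ ℂ) : ‖D k f‖ ≤ ν⁻¹ * ‖f‖ := by
    by_cases hk : k = 0
    · simp only [D, hk, dite_true, zero_apply, norm_zero]
      positivity
    · simp only [D, hk, dite_false]
      exact norm_duhamel_apply_le hν (hz k hk) f
  have hele (k : ℤ) : ‖e k‖ ≤ ‖a₀ k‖ := by
    by_cases hk : k = 0
    · simp [e, hk]
    · simp only [e, hk, dite_false]
      exact norm_freeEvolution_le _ _
  have he : Summable fun k => ‖e k‖ := .of_nonneg_of_le (fun _ => norm_nonneg _) hele hsum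
  have hsmall' : 4 * ν⁻¹ * ∑' k, ‖e k‖ < 1 := by
    have h := (he.tsum_le_tsum hele hsum).trans_lt hsmall
    calc 4 * ν⁻¹ * ∑' k, ‖e k‖ < 4 * ν⁻¹ * (ν / 4) := by gcongr
      _ = 1 := by field_simp
  obtain ⟨x, hx, hxeq⟩ :=
    exists_summable_eq_add_convolution hm D (inv_pos.mpr hν) hD e he hsmall'
  refine ⟨fun t k => x k t, fun t _ => ?_,
    ⟨fun k => ‖x k‖, hx, fun k t _ => (x k).norm_coe_le_norm t⟩, fun t ht k hk => ?_⟩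
  · change x 0 t = 0
    rw [hxeq 0]
    simp [e, D]
  set N : ℝ →ᵇ ℂ := ∑' j, x j * (m (k - j) • x (k - j)) with hN
  have hNapply (s : ℝ) : N s = ∑' j, x j s * m (k - j) * x (k - j) s := by
    have h := (summable_norm_mul_smul hm hx hx k).of_norm
    have h1 := (BoundedContinuousFunction.evalCLM ℂ s).map_tsum h
    rw [← hN] at h1
    simp only [mul_assoc]
    exact h1
  have hmild (t : ℝ) (ht : 0 ≤ t) : x k t = Complex.exp (-z k * t) * a₀ k +
      ∫ s in (0 : ℝ)..t, Complex.exp (-z k * (t - s)) * N s := by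
    conv_lhs => rw [hxeq k, ← hN]
    simp only [e, D, hk, dite_false, BoundedContinuousFunction.add_apply]
    rw [freeEvolution_apply _ _ ht, duhamel_apply _ _ _ ht]
  have h := duhamel_change_exponent (z k) (ν * |(k : ℝ)| ^ σ : ℝ) (a₀ k) N.continuous hmild ht
  change x k t = _
  rw [h]
  congr 1
  · push_cast
    ring_nf
  · refine intervalIntegral.integral_congr fun s _ => ?_
    simp only [hNapply, z, m]
    congr 1
    · push_cast
      ring_nf
    · ring
end

section
/- Let f₀ : [0,∞) → ℝ be defined by f₀(x) = (x²-1)² + ((x²+1)²/x)(x²-1)·arctan(x) for x > 0 and f₀(0) = 0. Then: (a) for x ≥ 0, f₀(x) = 0 if and only if x = 0 or x = 1; (b) f₀(x) < 0 if and only if x ∈ (0,1); (c) f₀(x) > 0 if and only if x ∈ (1,∞). -/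
/-- The auxiliary function `f₀(x) = (x²-1)² + ((x²+1)²/x)(x²-1)·arctan x` for `x > 0`,
extended by `f₀(0) = 0`. -/
noncomputable def f₀ (x : ℝ) : ℝ :=
  if x = 0 then 0
  else (x ^ 2 - 1) ^ 2 + ((x ^ 2 + 1) ^ 2 / x) * (x ^ 2 - 1) * Real.arctan x

theorem Real.div_one_add_sq_lt_arctan {x : ℝ} (hx : 0 < x) : x / (1 + x ^ 2) < Real.arctan x := by
  have h := Real.sin_lt (x := 2 * Real.arctan x) (by linarith [Real.arctan_pos.2 hx])
  have h_cos : Real.cos (Real.arctan x) ≠ 0 := (Real.cos_arctan_pos x).ne'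
  have h_sin : Real.sin (2 * Real.arctan x) = 2 * (x / (1 + x ^ 2)) := by
    calc Real.sin (2 * Real.arctan x)
        = 2 * (Real.tan (Real.arctan x) * Real.cos (Real.arctan x) ^ 2) := by
          rw [Real.sin_two_mul, Real.tan_eq_sin_div_cos]
          field_simp
      _ = 2 * (x / (1 + x ^ 2)) := by
          rw [Real.tan_arctan, Real.cos_sq_arctan, mul_one_div]
  linarith

/-- For `x > 0`, `f₀ x` has the sign of `x ^ 2 - 1`. -/
theorem exists_pos_f₀_eq_mul {x : ℝ} (hx : 0 < x) : ∃ c : ℝ, 0 < c ∧ f₀ x = (x ^ 2 - 1) * c := by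
  refine ⟨x ^ 2 - 1 + (x ^ 2 + 1) ^ 2 / x * Real.arctan x, ?_, ?_⟩
  · have h : (x ^ 2 + 1) ^ 2 / x * (x / (1 + x ^ 2)) < (x ^ 2 + 1) ^ 2 / x * Real.arctan x :=
      mul_lt_mul_of_pos_left (Real.div_one_add_sq_lt_arctan hx) (by positivity)
    have h_eq : (x ^ 2 + 1) ^ 2 / x * (x / (1 + x ^ 2)) = x ^ 2 + 1 := by
      field_simp
      ring
    nlinarith [sq_nonneg x]
  · rw [f₀, if_neg hx.ne']
    ring

/-- Sign properties of the auxiliary function `f₀` on `[0,∞)`: its only zeros are `0` and `1`,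
it is negative exactly on `(0,1)` and positive exactly on `(1,∞)`. -/
theorem f₀_sign_properties :
    (∀ x : ℝ, 0 ≤ x → (f₀ x = 0 ↔ x = 0 ∨ x = 1)) ∧
    (∀ x : ℝ, 0 ≤ x → (f₀ x < 0 ↔ 0 < x ∧ x < 1)) ∧
    (∀ x : ℝ, 0 ≤ x → (0 < f₀ x ↔ 1 < x)) := by
  have h_zero : f₀ 0 = 0 := if_pos rfl
  have h_one : f₀ 1 = 0 := by simp [f₀]
  have h_neg {x : ℝ} (h0 : 0 < x) (h1 : x < 1) : f₀ x < 0 := by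
    obtain ⟨c, hc, h⟩ := exists_pos_f₀_eq_mul h0
    rw [h]
    exact mul_neg_of_neg_of_pos (by nlinarith) hc
  have h_pos {x : ℝ} (h1 : 1 < x) : 0 < f₀ x := by
    obtain ⟨c, hc, h⟩ := exists_pos_f₀_eq_mul (zero_lt_one.trans h1)
    rw [h]
    exact mul_pos (by nlinarith) hc
  have h_cases {x : ℝ} (hx : 0 ≤ x) : x = 0 ∨ (0 < x ∧ x < 1) ∨ x = 1 ∨ 1 < x := by
    grind
  refine ⟨fun x hx => ?_, fun x hx => ?_, fun x hx => ?_⟩ <;>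
    rcases h_cases hx with rfl | ⟨h0, h1⟩ | rfl | h1 <;> grind
end

section
/- Let f_∞ : (0,∞) → ℝ be defined by f_∞(x) = (x²-1)² + ((x²+1)²/x)(x²-1)·(arctan(x) - π/2). Then: (a) for x > 0, f_∞(x) = 0 if and only if x = 1; (b) f_∞(x) > 0 for x ∈ (0,1); (c) f_∞(x) < 0 for all x > 1. -/
/-- The auxiliary function `f_∞(x) = (x²-1)² + ((x²+1)²/x)(x²-1)·(arctan x - π/2)`
for `x > 0`. -/
noncomputable def fInfty (x : ℝ) : ℝ :=
  (x ^ 2 - 1) ^ 2 + ((x ^ 2 + 1) ^ 2 / x) * (x ^ 2 - 1) * (Real.arctan x - Real.pi / 2)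

theorem div_one_add_sq_lt_pi_div_two_sub_arctan (x : ℝ) :
    x / (1 + x ^ 2) < Real.pi / 2 - Real.arctan x := by
  have hpos : 0 < Real.pi / 2 - Real.arctan x := sub_pos.2 (Real.arctan_lt_pi_div_two x)
  have hsin : Real.sin (2 * (Real.pi / 2 - Real.arctan x)) = 2 * (x / (1 + x ^ 2)) := by
    have hx : (0 : ℝ) ≤ 1 + x ^ 2 := by positivity
    rw [Real.sin_two_mul, Real.sin_pi_div_two_sub, Real.cos_pi_div_two_sub, Real.sin_arctan,
      Real.cos_arctan, mul_assoc, div_mul_div_comm, Real.mul_self_sqrt hx, one_mul]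
  have := Real.sin_lt (mul_pos two_pos hpos)
  linarith

theorem exists_neg_fInfty_eq_mul {x : ℝ} (hx : 0 < x) :
    ∃ b < 0, fInfty x = (x ^ 2 - 1) * b := by
  refine ⟨x ^ 2 - 1 - (x ^ 2 + 1) ^ 2 / x * (Real.pi / 2 - Real.arctan x), ?_, ?_⟩
  · have hlt := mul_lt_mul_of_pos_left (div_one_add_sq_lt_pi_div_two_sub_arctan x)
      (show 0 < (x ^ 2 + 1) ^ 2 / x by positivity)
    have heq : (x ^ 2 + 1) ^ 2 / x * (x / (1 + x ^ 2)) = x ^ 2 + 1 := by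
      field_simp
      ring
    linarith
  · unfold fInfty
    ring

/-- Sign properties of `f_∞` on `(0,∞)`: its only zero is `1`, it is positive on `(0,1)`
and negative on `(1,∞)`. -/
theorem fInfty_sign_properties :
    (∀ x : ℝ, 0 < x → (fInfty x = 0 ↔ x = 1)) ∧
    (∀ x : ℝ, 0 < x → x < 1 → 0 < fInfty x) ∧
    (∀ x : ℝ, 1 < x → fInfty x < 0) := by
  refine ⟨fun x hx ↦ ?_, fun x hx hx1 ↦ ?_, fun x hx ↦ ?_⟩
  · obtain ⟨b, hb, h⟩ := exists_neg_fInfty_eq_mul hx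
    rw [h, mul_eq_zero, or_iff_left hb.ne, sub_eq_zero,
      pow_eq_one_iff_of_nonneg hx.le two_ne_zero]
  · obtain ⟨b, hb, h⟩ := exists_neg_fInfty_eq_mul hx
    rw [h]
    exact mul_pos_of_neg_of_neg (by nlinarith) hb
  · obtain ⟨b, hb, h⟩ := exists_neg_fInfty_eq_mul (zero_lt_one.trans hx)
    rw [h]
    exact mul_neg_of_pos_of_neg (by nlinarith) hb
end

section
/- For every real x > 0, one has x(x²-1)/(x²+1)² < π/2 - arctan(x). -/
theorem sin_four_mul_arctan (x : ℝ) :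
    Real.sin (4 * Real.arctan x) = 4 * (x * (1 - x ^ 2) / (x ^ 2 + 1) ^ 2) := by
  have hc : Real.cos (Real.arctan x) ^ 2 = 1 / (1 + x ^ 2) := Real.cos_sq_arctan x
  have hs : Real.sin (Real.arctan x) = x * Real.cos (Real.arctan x) := by
    conv_rhs => rw [← Real.tan_arctan x, Real.arctan_tan (Real.neg_pi_div_two_lt_arctan x)
      (Real.arctan_lt_pi_div_two x)]
    exact (Real.tan_mul_cos (Real.cos_arctan_pos x).ne').symm
  have hx : (1 : ℝ) + x ^ 2 ≠ 0 := by positivity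
  calc Real.sin (4 * Real.arctan x)
      = Real.sin (2 * (2 * Real.arctan x)) := by ring_nf
    _ = 4 * x * Real.cos (Real.arctan x) ^ 2 * (2 * Real.cos (Real.arctan x) ^ 2 - 1) := by
      rw [Real.sin_two_mul, Real.sin_two_mul, Real.cos_two_mul, hs]
      ring
    _ = 4 * (x * (1 - x ^ 2) / (x ^ 2 + 1) ^ 2) := by
      rw [hc, add_comm (x ^ 2)]
      field_simp
      ring

/-- For every real `x > 0`, one has `x(x²-1)/(x²+1)² < π/2 - arctan x`. -/
theorem arctan_upper_bound (x : ℝ) (hx : 0 < x) :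
    x * (x ^ 2 - 1) / (x ^ 2 + 1) ^ 2 < Real.pi / 2 - Real.arctan x := by
  have hpos : 0 < 4 * (Real.pi / 2 - Real.arctan x) := by
    linarith [Real.arctan_lt_pi_div_two x]
  have hsin : Real.sin (4 * (Real.pi / 2 - Real.arctan x)) =
      4 * (x * (x ^ 2 - 1) / (x ^ 2 + 1) ^ 2) := by
    rw [show 4 * (Real.pi / 2 - Real.arctan x) = 2 * Real.pi - 4 * Real.arctan x by ring,
      Real.sin_two_pi_sub, sin_four_mul_arctan]
    ring
  linarith [Real.sin_lt hpos]
end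

section
/- (Necessary condition for type B blowup, a = 1/2, σ = 0.) Let ν > 0, let ω₀ be a nonzero real number, let v₀ > 0, and suppose there exists t_c ∈ (0,∞) such that e^{-ν t_c} - 1 = (ν/(2ω₀))·f_∞(v₀). Then either (0 < v₀ < 1 and ω₀ < -(ν/2)f_∞(v₀)) or (v₀ > 1 and ω₀ > -(ν/2)f_∞(v₀)). -/
theorem lt_mul_pi_div_two_sub_arctan {x : ℝ} (hx : 0 < x) :
    x < (x ^ 2 + 1) * (Real.pi / 2 - Real.arctan x) := by
  set r := √(1 + x ^ 2) with hr
  have hr0 : 0 < r := by positivity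
  have hr2 : r ^ 2 = 1 + x ^ 2 := Real.sq_sqrt (by positivity)
  have hxr : x < r := by nlinarith
  have hθ : 0 < Real.pi / 2 - Real.arctan x := by linarith [Real.arctan_lt_pi_div_two x]
  have h := Real.sin_lt hθ
  rw [Real.sin_pi_div_two_sub, Real.cos_arctan, ← hr, div_lt_iff₀ hr0] at h
  nlinarith

theorem fInfty_pos {x : ℝ} (hx : 0 < x) (hx1 : x < 1) : 0 < fInfty x := by
  obtain ⟨b, hb, h⟩ := exists_neg_fInfty_eq_mul hx
  rw [h]
  exact mul_pos_of_neg_of_neg (by nlinarith) hb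

theorem fInfty_neg {x : ℝ} (hx1 : 1 < x) : fInfty x < 0 := by
  obtain ⟨b, hb, h⟩ := exists_neg_fInfty_eq_mul (zero_lt_one.trans hx1)
  rw [h]
  exact mul_neg_of_pos_of_neg (by nlinarith) hb

theorem fInfty_one : fInfty 1 = 0 := by simp [fInfty]

/-- Necessary condition for type B blowup (`a = 1/2`, `σ = 0`): if the transcendental
equation `e^{-ν t_c} - 1 = (ν/(2ω₀)) f_∞(v₀)` has a solution `t_c ∈ (0,∞)`, then either
`0 < v₀ < 1` and `ω₀ < -(ν/2) f_∞(v₀)`, or `v₀ > 1` and `ω₀ > -(ν/2) f_∞(v₀)`. -/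
theorem typeB_blowup_necessary
    (ν ω₀ v₀ : ℝ) (hν : 0 < ν) (hω₀ : ω₀ ≠ 0) (hv₀ : 0 < v₀)
    (htc : ∃ tc : ℝ, 0 < tc ∧ Real.exp (-(ν * tc)) - 1 = ν / (2 * ω₀) * fInfty v₀) :
    (0 < v₀ ∧ v₀ < 1 ∧ ω₀ < -(ν / 2) * fInfty v₀) ∨
    (1 < v₀ ∧ -(ν / 2) * fInfty v₀ < ω₀) := by
  obtain ⟨tc, htc0, h⟩ := htc
  have hlt : Real.exp (-(ν * tc)) < 1 := by rw [Real.exp_lt_one_iff]; nlinarith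
  have hpos := Real.exp_pos (-(ν * tc))
  set q := Real.exp (-(ν * tc)) - 1 with hq
  have hq0 : q < 0 := by linarith
  have hq1 : 0 < q + 1 := by linarith
  have key : ν / 2 * fInfty v₀ = q * ω₀ := by
    rw [h]
    field_simp
  rcases lt_trichotomy v₀ 1 with h1 | h1 | h1
  · left
    have hf : 0 < ν / 2 * fInfty v₀ := mul_pos (by positivity) (fInfty_pos hv₀ h1)
    have hω : ω₀ < 0 := by
      by_contra! hc
      nlinarith
    exact ⟨hv₀, h1, by nlinarith⟩
  · rw [h1, fInfty_one, mul_zero] at h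
    exact absurd h hq0.ne
  · right
    have hf : ν / 2 * fInfty v₀ < 0 := mul_neg_of_pos_of_neg (by positivity) (fInfty_neg h1)
    have hω : 0 < ω₀ := by
      by_contra! hc
      nlinarith
    exact ⟨h1, by nlinarith⟩
end

section
/- (Sufficient condition for type A blowup, a = 1/2, σ = 0.) Let ν > 0, let v₀ > 0 with v₀ ≠ 1, and let ω₀ ∈ ℝ satisfy either (0 < v₀ < 1 and ω₀ > -(ν/2)f₀(v₀)) or (v₀ > 1 and ω₀ < -(ν/2)f₀(v₀)). Suppose v : [0,∞) → ℝ is continuous with v(0) = v₀ and satisfies, for all t ≥ 0, f₁(v(t)) = f₀(v₀)·f₂(v₀) + (2ω₀/ν)·f₂(v₀)·(1 - e^{-νt}). Then there exists t ≥ 0 with v(t) = 0. -/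
/-- The function `f₁(v) = v(v²-1)/(v²+1)² + arctan v`. -/
noncomputable def f₁ (v : ℝ) : ℝ :=
  v * (v ^ 2 - 1) / (v ^ 2 + 1) ^ 2 + Real.arctan v

/-- The function `f₂(v) = v/((v²-1)(v²+1)²)`. -/
noncomputable def f₂ (v : ℝ) : ℝ :=
  v / ((v ^ 2 - 1) * (v ^ 2 + 1) ^ 2)

theorem hasDerivAt_f₁ (x : ℝ) : HasDerivAt f₁ (8 * x ^ 2 / (x ^ 2 + 1) ^ 3) x := by
  have hx : x ^ 2 + 1 ≠ 0 := by positivity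
  have hx' : 1 + x ^ 2 ≠ 0 := by positivity
  have hsq : HasDerivAt (fun y : ℝ => y ^ 2) (2 * x) x := by
    simpa using hasDerivAt_pow 2 x
  have hnum := (hasDerivAt_id' x).fun_mul (hsq.sub_const 1)
  have hden := (hsq.add_const 1).fun_pow 2
  have h := (hnum.fun_div hden (pow_ne_zero 2 hx)).fun_add (Real.hasDerivAt_arctan x)
  refine h.congr_deriv ?_
  rw [add_comm 1 (x ^ 2)]
  field_simp
  ring

theorem monotone_f₁ : Monotone f₁ :=
  monotone_of_deriv_nonneg (fun x => (hasDerivAt_f₁ x).differentiableAt) fun x => by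
    rw [(hasDerivAt_f₁ x).deriv]
    positivity

theorem f₁_nonneg {x : ℝ} (hx : 0 ≤ x) : 0 ≤ f₁ x := by
  simpa [f₁] using monotone_f₁ hx

/-- Sufficient condition for type A blowup (`a = 1/2`, `σ = 0`): under the stated sign
conditions on `(v₀, ω₀)`, any continuous function `v` on `[0,∞)` with `v(0) = v₀` satisfying
the implicit solution identity must reach `0`. -/
theorem typeA_blowup_sufficient
    (ν ω₀ v₀ : ℝ) (hν : 0 < ν) (hv₀ : 0 < v₀) (hv₀' : v₀ ≠ 1)
    (hcond : (0 < v₀ ∧ v₀ < 1 ∧ -(ν / 2) * f₀ v₀ < ω₀) ∨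
      (1 < v₀ ∧ ω₀ < -(ν / 2) * f₀ v₀))
    (v : ℝ → ℝ) (hcont : ContinuousOn v (Set.Ici 0)) (hv0 : v 0 = v₀)
    (hsol : ∀ t : ℝ, 0 ≤ t →
      f₁ (v t) = f₀ v₀ * f₂ v₀ + (2 * ω₀ / ν) * f₂ v₀ * (1 - Real.exp (-(ν * t)))) :
    ∃ t : ℝ, 0 ≤ t ∧ v t = 0 := by
  have hneg : f₀ v₀ * f₂ v₀ + (2 * ω₀ / ν) * f₂ v₀ * (1 - 0) < 0 := by
    have hω : ω₀ = ν / 2 * (2 * ω₀ / ν) := by field_simp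
    have hfactor : f₀ v₀ * f₂ v₀ + (2 * ω₀ / ν) * f₂ v₀ * (1 - 0) =
        (f₀ v₀ + 2 * ω₀ / ν) * f₂ v₀ := by ring
    rw [hfactor]
    rcases hcond with ⟨-, h1, h⟩ | ⟨h1, h⟩
    · refine mul_neg_of_pos_of_neg ?_ ?_
      · have : 0 < ν / 2 * (f₀ v₀ + 2 * ω₀ / ν) := by linarith
        exact pos_of_mul_pos_right this (by positivity)
      · refine div_neg_of_pos_of_neg hv₀ (mul_neg_of_neg_of_pos ?_ (by positivity))
        nlinarith
    · refine mul_neg_of_neg_of_pos ?_ ?_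
      · have : ν / 2 * (f₀ v₀ + 2 * ω₀ / ν) < 0 := by linarith
        exact neg_of_mul_neg_right this (by positivity)
      · refine div_pos hv₀ (mul_pos ?_ (by positivity))
        nlinarith
  have hexp : Filter.Tendsto (fun t : ℝ => Real.exp (-(ν * t))) Filter.atTop (nhds 0) :=
    Real.tendsto_exp_neg_atTop_nhds_zero.comp (Filter.tendsto_id.const_mul_atTop hν)
  have hlim := ((hexp.const_sub 1).const_mul ((2 * ω₀ / ν) * f₂ v₀)).const_add (f₀ v₀ * f₂ v₀)
  obtain ⟨T, hT, hT0⟩ :=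
    ((hlim.eventually_lt_const hneg).and (Filter.eventually_ge_atTop 0)).exists
  have hvT : v T < 0 := by
    by_contra! h
    have := f₁_nonneg h
    rw [hsol T hT0] at this
    exact absurd hT this.not_gt
  obtain ⟨t, ht, hvt⟩ := intermediate_value_Icc' hT0
    (hcont.mono Set.Icc_subset_Ici_self) ⟨hvT.le, hv0.symm ▸ hv₀.le⟩
  exact ⟨t, ht.1, hvt⟩
end

section
/- (Sufficient condition for type B blowup, a = 1/2, σ = 0.) Let ν > 0, let v₀ > 0 with v₀ ≠ 1, and let ω₀ ∈ ℝ satisfy either (0 < v₀ < 1 and ω₀ < -(ν/2)f_∞(v₀)) or (v₀ > 1 and ω₀ > -(ν/2)f_∞(v₀)). Then there exists NO continuous function v : [0,∞) → ℝ with v(t) > 0 for all t ≥ 0, v(0) = v₀, satisfying for all t ≥ 0 the identity f₁(v(t)) = f_∞(v₀)·f₂(v₀) + (2ω₀/ν)·f₂(v₀)·(1 - e^{-νt}) + π/2. -/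
/-- In the angle `θ = arctan v`, one has `f₁ v = θ - sin (4θ) / 4`. -/
lemma f₁_eq_arctan_sub_sin (v : ℝ) :
    f₁ v = Real.arctan v - Real.sin (4 * Real.arctan v) / 4 := by
  have hc : Real.cos (Real.arctan v) ≠ 0 := (Real.cos_arctan_pos v).ne'
  have hv : v = Real.sin (Real.arctan v) / Real.cos (Real.arctan v) := by
    rw [← Real.tan_eq_sin_div_cos, Real.tan_arctan]
  have h4 : Real.sin (4 * Real.arctan v) = 4 * Real.sin (Real.arctan v) *
      Real.cos (Real.arctan v) * (2 * Real.cos (Real.arctan v) ^ 2 - 1) := by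
    rw [show 4 * Real.arctan v = 2 * (2 * Real.arctan v) by ring, Real.sin_two_mul,
      Real.sin_two_mul, Real.cos_two_mul]
    ring
  have hsc := Real.sin_sq_add_cos_sq (Real.arctan v)
  rw [f₁, h4]
  generalize Real.arctan v = θ at *
  have h1 : v ^ 2 + 1 = 1 / Real.cos θ ^ 2 := by
    rw [hv]
    field_simp
    exact hsc
  have h2 : v ^ 2 - 1 = (1 - 2 * Real.cos θ ^ 2) / Real.cos θ ^ 2 := by
    rw [hv]
    field_simp
    linarith
  rw [h1, h2, hv]
  field_simp
  ring

lemma f₁_le_pi_div_two (v : ℝ) : f₁ v ≤ Real.pi / 2 := by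
  have h : Real.sin (2 * Real.pi - 4 * Real.arctan v) ≤ 2 * Real.pi - 4 * Real.arctan v :=
    Real.sin_le (by linarith [Real.arctan_lt_pi_div_two v])
  rw [Real.sin_two_pi_sub] at h
  rw [f₁_eq_arctan_sub_sin]
  linarith

/-- Sufficient condition for type B blowup (`a = 1/2`, `σ = 0`): under the stated sign
conditions on `(v₀, ω₀)`, there is no global positive continuous solution of the implicit
solution identity on `[0,∞)`. -/
theorem typeB_blowup_sufficient
    (ν ω₀ v₀ : ℝ) (hν : 0 < ν) (hv₀ : 0 < v₀) (hv₀' : v₀ ≠ 1)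
    (hcond : (0 < v₀ ∧ v₀ < 1 ∧ ω₀ < -(ν / 2) * fInfty v₀) ∨
      (1 < v₀ ∧ -(ν / 2) * fInfty v₀ < ω₀)) :
    ¬ ∃ v : ℝ → ℝ, ContinuousOn v (Set.Ici 0) ∧ (∀ t : ℝ, 0 ≤ t → 0 < v t) ∧
      v 0 = v₀ ∧
      ∀ t : ℝ, 0 ≤ t →
        f₁ (v t) = fInfty v₀ * f₂ v₀ + (2 * ω₀ / ν) * f₂ v₀ * (1 - Real.exp (-(ν * t)))
          + Real.pi / 2 := by
  rintro ⟨v, -, -, -, hv⟩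
  have hpos : 0 < (fInfty v₀ + 2 * ω₀ / ν) * f₂ v₀ := by
    have hω : fInfty v₀ + 2 * ω₀ / ν = 2 / ν * (ω₀ - -(ν / 2) * fInfty v₀) := by
      field_simp
      ring
    rw [hω, f₂]
    rcases hcond with ⟨-, h1, h⟩ | ⟨h1, h⟩
    · have hden : v₀ ^ 2 - 1 < 0 := by nlinarith
      exact mul_pos_of_neg_of_neg (mul_neg_of_pos_of_neg (by positivity) (by linarith))
        (div_neg_of_pos_of_neg hv₀ (mul_neg_of_neg_of_pos hden (by positivity)))
    · have hden : 0 < v₀ ^ 2 - 1 := by nlinarith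
      exact mul_pos (mul_pos (by positivity) (by linarith)) (by positivity)
  have hexp : Filter.Tendsto (fun t : ℝ => Real.exp (-(ν * t))) Filter.atTop (nhds 0) :=
    Real.tendsto_exp_neg_atTop_nhds_zero.comp (Filter.tendsto_id.const_mul_atTop hν)
  have hlim := (((hexp.const_sub 1).const_mul (2 * ω₀ / ν * f₂ v₀)).const_add
    (fInfty v₀ * f₂ v₀)).add_const (Real.pi / 2)
  have hle := le_of_tendsto hlim <| by
    filter_upwards [Filter.eventually_ge_atTop 0] with t ht
    exact (hv t ht).symm.trans_le (f₁_le_pi_div_two (v t))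
  linarith
end

section
/- (Exact pole-dynamics solution for a = 0, σ = 0, ν > 0, nonzero mean.) Let ν > 0, let ω_av0 be a nonzero real number, and let ω₀, v₀ ∈ ℂ with v₀ ≠ -1. Define ζ(t) = exp(i(ω_av0/ν)(1 - e^{-νt})), D(t) = 1 - (ω₀/(i·ω_av0·(1+v₀)))·(ζ(t) - 1), ω₋₁(t) = ω₀·e^{-νt}·ζ(t)/D(t)², v_c(t) = (v₀+1)/D(t) - 1, and ω_av(t) = ω_av0·e^{-νt}. Let T > 0 and suppose D(t) ≠ 0 for all t ∈ [0,T). Then for all t ∈ [0,T): ω₋₁'(t) = (i·ω_av(t) - ν)·ω₋₁(t) + 2ω₋₁(t)²/(1 + v_c(t)), v_c'(t) = ω₋₁(t), and ω_av'(t) = -ν·ω_av(t); moreover ω₋₁(0) = ω₀, v_c(0) = v₀, ω_av(0) = ω_av0. -/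
/-- Exact pole-dynamics solution for `a = 0`, `σ = 0`, `ν > 0`, with nonzero mean: the explicit
functions `ω₋₁, v_c, ω_av` solve the pole-dynamics ODE system
`ω₋₁' = (i ω_av - ν) ω₋₁ + 2ω₋₁²/(1+v_c)`, `v_c' = ω₋₁`, `ω_av' = -ν ω_av`
on `[0,T)` as long as the denominator `D` does not vanish. -/
theorem pole_dynamics_solution_a0_sigma0
    (ν ωav₀ : ℝ) (hν : 0 < ν) (hωav₀ : ωav₀ ≠ 0)
    (ω₀ v₀ : ℂ) (hv₀ : v₀ ≠ -1)
    (ζ D ωm1 vc ωav : ℝ → ℂ)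
    (hζ : ∀ t : ℝ, ζ t =
      Complex.exp (Complex.I * ((ωav₀ / ν : ℝ) : ℂ) * ((1 - Real.exp (-(ν * t)) : ℝ) : ℂ)))
    (hD : ∀ t : ℝ, D t = 1 - ω₀ / (Complex.I * (ωav₀ : ℂ) * (1 + v₀)) * (ζ t - 1))
    (hωm1 : ∀ t : ℝ, ωm1 t = ω₀ * (Real.exp (-(ν * t)) : ℂ) * ζ t / (D t) ^ 2)
    (hvc : ∀ t : ℝ, vc t = (v₀ + 1) / D t - 1)
    (hωav : ∀ t : ℝ, ωav t = ((ωav₀ * Real.exp (-(ν * t)) : ℝ) : ℂ))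
    (T : ℝ) (hT : 0 < T)
    (hDne : ∀ t ∈ Set.Ico (0 : ℝ) T, D t ≠ 0) :
    (∀ t ∈ Set.Ico (0 : ℝ) T,
      HasDerivAt ωm1 ((Complex.I * ωav t - (ν : ℂ)) * ωm1 t + 2 * (ωm1 t) ^ 2 / (1 + vc t)) t ∧
      HasDerivAt vc (ωm1 t) t ∧
      HasDerivAt ωav (-(ν : ℂ) * ωav t) t) ∧
    ωm1 0 = ω₀ ∧ vc 0 = v₀ ∧ ωav 0 = (ωav₀ : ℂ) := by
  have hω : (ωav₀ : ℂ) ≠ 0 := Complex.ofReal_ne_zero.mpr hωav₀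
  have hν' : (ν : ℂ) ≠ 0 := Complex.ofReal_ne_zero.mpr hν.ne'
  have hv : 1 + v₀ ≠ 0 := fun h => hv₀ (by linear_combination h)
  have hζ0 : ζ 0 = 1 := by simp [hζ]
  have hD0 : D 0 = 1 := by simp [hD, hζ0]
  have hexp (t : ℝ) : HasDerivAt (fun s : ℝ => Real.exp (-(ν * s)))
      (-ν * Real.exp (-(ν * t))) t := by
    refine ((hasDerivAt_id t).const_mul ν).neg.exp.congr_deriv ?_
    simp
    ring
  have hζd (t : ℝ) : HasDerivAt ζ (Complex.I * ωav t * ζ t) t := by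
    have h := ((((hexp t).const_sub 1).ofReal_comp).const_mul
      (Complex.I * ((ωav₀ / ν : ℝ) : ℂ))).cexp
    rw [funext hζ, hωav]
    refine h.congr_deriv ?_
    push_cast
    field_simp
  have hDd (t : ℝ) :
      HasDerivAt D (-(ω₀ * (Real.exp (-(ν * t)) : ℂ) * ζ t / (1 + v₀))) t := by
    have h := (((hζd t).sub_const 1).const_mul
      (ω₀ / (Complex.I * (ωav₀ : ℂ) * (1 + v₀)))).const_sub 1
    rw [funext hD]
    refine h.congr_deriv ?_
    rw [hωav]
    push_cast
    field_simp [Complex.I_ne_zero]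
  refine ⟨fun t ht => ?_, ?_, ?_, ?_⟩
  · have hDt := hDne t ht
    refine ⟨?_, ?_, ?_⟩
    · have h := (((hexp t).ofReal_comp.const_mul ω₀).mul (hζd t)).div ((hDd t).pow 2)
        (pow_ne_zero 2 hDt)
      have hvt : 1 + vc t = (1 + v₀) / D t := by rw [hvc]; ring
      rw [hvt, hωm1 t, funext hωm1]
      refine h.congr_deriv ?_
      simp only [Pi.mul_apply, Pi.pow_apply]
      push_cast
      field_simp
      ring
    · have h := ((hasDerivAt_const t (v₀ + 1)).div (hDd t) hDt).sub_const 1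
      rw [hωm1, funext hvc]
      refine h.congr_deriv ?_
      field_simp
      ring
    · have h := ((hexp t).const_mul ωav₀).ofReal_comp
      rw [hωav t, funext hωav]
      refine h.congr_deriv ?_
      push_cast
      ring
  · simp [hωm1, hζ0, hD0]
  · simp [hvc, hD0]
  · simp [hωav]
end

section
/- (Inviscid pole-dynamics solution and finite-time collapse for a = 0, σ = 0, ν = 0.) Let ω₀, v₀ ∈ ℂ with v₀ ≠ -1, and define ω(t) = ω₀/(1 - (ω₀/(1+v₀))t)² and v(t) = (v₀ + (ω₀/(1+v₀))t)/(1 - (ω₀/(1+v₀))t). Then: (a) for every t with 1 - (ω₀/(1+v₀))t ≠ 0 one has v'(t) = ω(t) and ω'(t) = 2ω(t)²/(1 + v(t)); (b) if moreover ω₀ and v₀ are real with ω₀ < 0 and v₀ > 0, then t_c := -v₀(1+v₀)/ω₀ satisfies t_c > 0, the denominator 1 - (ω₀/(1+v₀))t is nonzero for all t ∈ [0, t_c], v(t) > 0 for t ∈ [0, t_c), and v(t_c) = 0. -/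
/-- Inviscid pole-dynamics solution and finite-time collapse for `a = 0`, `σ = 0`, `ν = 0`:
(a) the explicit functions `ω, v` solve `v' = ω`, `ω' = 2ω²/(1+v)` wherever the denominator
does not vanish; (b) for real data with `ω₀ < 0 < v₀`, the pole position `v` stays positive
up to the collapse time `t_c = -v₀(1+v₀)/ω₀ > 0` and vanishes there. -/
theorem inviscid_pole_dynamics_collapse_a0_sigma0
    (ω₀ v₀ : ℂ) (hv₀ : v₀ ≠ -1)
    (ω v : ℝ → ℂ)
    (hω : ∀ t : ℝ, ω t = ω₀ / (1 - ω₀ / (1 + v₀) * (t : ℂ)) ^ 2)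
    (hv : ∀ t : ℝ, v t = (v₀ + ω₀ / (1 + v₀) * (t : ℂ)) / (1 - ω₀ / (1 + v₀) * (t : ℂ))) :
    (∀ t : ℝ, 1 - ω₀ / (1 + v₀) * (t : ℂ) ≠ 0 →
      HasDerivAt v (ω t) t ∧ HasDerivAt ω (2 * (ω t) ^ 2 / (1 + v t)) t) ∧
    (∀ a b : ℝ, ω₀ = (a : ℂ) → v₀ = (b : ℂ) → a < 0 → 0 < b →
      0 < -b * (1 + b) / a ∧
      (∀ t ∈ Set.Icc (0 : ℝ) (-b * (1 + b) / a), 1 - ω₀ / (1 + v₀) * (t : ℂ) ≠ 0) ∧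
      (∀ t ∈ Set.Ico (0 : ℝ) (-b * (1 + b) / a), (v t).im = 0 ∧ 0 < (v t).re) ∧
      v (-b * (1 + b) / a) = 0) := by
  have h1 : 1 + v₀ ≠ 0 := fun h => hv₀ (by linear_combination h)
  refine ⟨fun t hD => ?_, ?_⟩
  · obtain rfl : ω = _ := funext hω
    obtain rfl : v = _ := funext hv
    beta_reduce
    obtain ⟨k, hk⟩ : ∃ k, k = ω₀ / (1 + v₀) := ⟨_, rfl⟩
    obtain rfl : ω₀ = k * (1 + v₀) := by rw [hk]; field_simp
    rw [← hk] at hD ⊢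
    have hlin : HasDerivAt (fun s : ℝ => k * (s : ℂ)) k t := by
      simpa using (HasDerivAt.ofReal_comp (hasDerivAt_id t)).const_mul k
    have hden : HasDerivAt (fun s : ℝ => 1 - k * (s : ℂ)) (-k) t := hlin.const_sub 1
    have hsum : 1 + (v₀ + k * (t : ℂ)) / (1 - k * (t : ℂ)) = (1 + v₀) / (1 - k * (t : ℂ)) := by
      field_simp
      ring
    constructor
    · refine ((hlin.const_add v₀).fun_div hden hD).congr_deriv ?_
      field_simp
      ring
    · rw [hsum]
      refine ((hasDerivAt_const t (k * (1 + v₀))).fun_div (hden.fun_pow 2)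
        (pow_ne_zero 2 hD)).congr_deriv ?_
      push_cast
      field_simp
      ring
  · rintro a b rfl rfl ha hb
    have hb1 : 0 < 1 + b := by linarith
    have hr : a / (1 + b) < 0 := div_neg_of_neg_of_pos ha hb1
    have htc : 0 < -b * (1 + b) / a := div_pos_of_neg_of_neg (by nlinarith) ha
    have hrtc : a / (1 + b) * (-b * (1 + b) / a) = -b := by
      field_simp [ha.ne]
    have hden : ∀ t : ℝ, 0 ≤ t → 0 < 1 - a / (1 + b) * t := fun t ht => by
      nlinarith [mul_nonneg (neg_nonneg.2 hr.le) ht]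
    have hvreal : ∀ t : ℝ,
        v t = (((b + a / (1 + b) * t) / (1 - a / (1 + b) * t) : ℝ) : ℂ) := fun t => by
      rw [hv]
      push_cast
      rfl
    refine ⟨htc, fun t ht => ?_, fun t ht => ?_, ?_⟩
    · exact_mod_cast (hden t ht.1).ne'
    · rw [hvreal, Complex.ofReal_im, Complex.ofReal_re]
      refine ⟨rfl, div_pos ?_ (hden t ht.1)⟩
      linarith [mul_lt_mul_of_neg_left ht.2 hr]
    · have h := hvreal (-b * (1 + b) / a)
      rw [hrtc, add_neg_cancel, zero_div, Complex.ofReal_zero] at h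
      exact_mod_cast h
end

section
/- (Finite-time collapse for a = 0, σ = 0, ν > 0, real data.) Let ν > 0 and let ω₀, v₀ be real with v₀ > 0 and ω₀ < -ν·v₀(1+v₀). Define, for t ≥ 0, E(t) = 1 - (ω₀/(ν(1+v₀)))(1 - e^{-νt}), ω(t) = ω₀·e^{-νt}/E(t)², and v(t) = (v₀+1)/E(t) - 1. Then t_c := (1/ν)·ln( ω₀/(ω₀ + ν·v₀(1+v₀)) ) satisfies 0 < t_c < ∞, E(t) > 0 for all t ∈ [0, t_c], v(t) > 0 for t ∈ [0, t_c), and v(t_c) = 0. -/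
/-- Finite-time collapse for `a = 0`, `σ = 0`, `ν > 0` and real data: for
`ω₀ < -ν v₀(1+v₀)` the explicit pole-dynamics solution has a positive collapse time
`t_c = (1/ν) ln(ω₀/(ω₀ + ν v₀(1+v₀)))` at which the pole position `v` reaches `0`,
while `E > 0` on `[0,t_c]` and `v > 0` on `[0,t_c)`. -/
theorem pole_dynamics_collapse_a0_sigma0_viscous
    (ν ω₀ v₀ : ℝ) (hν : 0 < ν) (hv₀ : 0 < v₀)
    (hω₀ : ω₀ < -(ν * v₀ * (1 + v₀)))
    (E ω v : ℝ → ℝ)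
    (hE : ∀ t : ℝ, E t = 1 - ω₀ / (ν * (1 + v₀)) * (1 - Real.exp (-(ν * t))))
    (hω : ∀ t : ℝ, ω t = ω₀ * Real.exp (-(ν * t)) / (E t) ^ 2)
    (hv : ∀ t : ℝ, v t = (v₀ + 1) / E t - 1) :
    0 < (1 / ν) * Real.log (ω₀ / (ω₀ + ν * v₀ * (1 + v₀))) ∧
    (∀ t ∈ Set.Icc (0 : ℝ) ((1 / ν) * Real.log (ω₀ / (ω₀ + ν * v₀ * (1 + v₀)))), 0 < E t) ∧
    (∀ t ∈ Set.Ico (0 : ℝ) ((1 / ν) * Real.log (ω₀ / (ω₀ + ν * v₀ * (1 + v₀)))), 0 < v t) ∧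
    v ((1 / ν) * Real.log (ω₀ / (ω₀ + ν * v₀ * (1 + v₀)))) = 0 := by
  set D := ω₀ + ν * v₀ * (1 + v₀) with hD
  set T := (1 / ν) * Real.log (ω₀ / D) with hT
  have hpos : 0 < ν * v₀ * (1 + v₀) := by positivity
  have hD_neg : D < 0 := by linarith
  have hω_neg : ω₀ < 0 := by linarith
  have hT_pos : 0 < T := by
    refine mul_pos (by positivity) (Real.log_pos ?_)
    rw [one_lt_div_of_neg hD_neg]
    linarith
  have hexp : Real.exp (-(ν * T)) = D / ω₀ := by
    have hνT : ν * T = Real.log (ω₀ / D) := by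
      rw [hT]
      field_simp
    rw [hνT, Real.exp_neg, Real.exp_log (div_pos_of_neg_of_neg hω_neg hD_neg), inv_div]
  have hc : ω₀ / (ν * (1 + v₀)) < 0 := div_neg_of_neg_of_pos hω_neg (by positivity)
  have hE_mono : StrictMono E := by
    intro s t hst
    have hlt : Real.exp (-(ν * t)) < Real.exp (-(ν * s)) :=
      Real.exp_lt_exp.mpr (neg_lt_neg (mul_lt_mul_of_pos_left hst hν))
    rw [hE, hE]
    exact sub_lt_sub_left (mul_lt_mul_of_neg_left (sub_lt_sub_left hlt 1) hc) 1
  have hE_zero : E 0 = 1 := by simp [hE]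
  have hE_T : E T = v₀ + 1 := by
    have hω_ne : ω₀ ≠ 0 := hω_neg.ne
    have hv_ne : 1 + v₀ ≠ 0 := by positivity
    rw [hE, hexp, hD]
    field_simp
    ring
  have hE_pos : ∀ t, 0 ≤ t → 0 < E t := fun t ht => by
    have := hE_mono.monotone ht
    linarith
  refine ⟨hT_pos, fun t ht => hE_pos t ht.1, fun t ht => ?_, ?_⟩
  · rw [hv, sub_pos, one_lt_div (hE_pos t ht.1), ← hE_T]
    exact hE_mono ht.2
  · rw [hv, hE_T, div_self (by positivity), sub_self]
end

section
/- (Exact pole-dynamics solution for a = 0, σ = 1.) Let ν > 0, let ω_av be a nonzero real number, and let ω₀, v₀ ∈ ℂ with v₀ ≠ -1. Define Z₊(t) = 1 - (ω₀/(1+v₀))·(e^{i·ω_av·t} - 1)/(i·ω_av) + ((e^{νt} - 1)/2)(1+v₀), Z₋(t) = 1 - (ω₀/(1+v₀))·(e^{i·ω_av·t} - 1)/(i·ω_av) + ((-e^{νt} - 1)/2)(1+v₀), ω₋₁(t) = ω₀·e^{(ν + i·ω_av)t}/Z₊(t)², and v(t) = -Z₋(t)/Z₊(t). Let T > 0 and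 suppose Z₊(t) ≠ 0 for all t ∈ [0,T). Then for all t ∈ [0,T): ω₋₁'(t) = (i·ω_av - ν·v(t))·ω₋₁(t) + 2ω₋₁(t)²/(1 + v(t)) and v'(t) = ω₋₁(t) + (ν/2)(1 - v(t)²); moreover ω₋₁(0) = ω₀ and v(0) = v₀. -/
/-- Exact pole-dynamics solution for `a = 0`, `σ = 1`: the explicit functions `ω₋₁, v`
built from `Z₊, Z₋` solve the pole-dynamics ODE system
`ω₋₁' = (i ω_av - ν v) ω₋₁ + 2ω₋₁²/(1+v)`, `v' = ω₋₁ + (ν/2)(1 - v²)`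
on `[0,T)` as long as `Z₊` does not vanish. -/
theorem pole_dynamics_solution_a0_sigma1
    (ν ωav : ℝ) (hν : 0 < ν) (hωav : ωav ≠ 0)
    (ω₀ v₀ : ℂ) (hv₀ : v₀ ≠ -1)
    (Zp Zm ωm1 v : ℝ → ℂ)
    (hZp : ∀ t : ℝ, Zp t =
      1 - ω₀ / (1 + v₀) * ((Complex.exp (Complex.I * (ωav : ℂ) * (t : ℂ)) - 1) /
        (Complex.I * (ωav : ℂ))) + (((Real.exp (ν * t) - 1) / 2 : ℝ) : ℂ) * (1 + v₀))
    (hZm : ∀ t : ℝ, Zm t =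
      1 - ω₀ / (1 + v₀) * ((Complex.exp (Complex.I * (ωav : ℂ) * (t : ℂ)) - 1) /
        (Complex.I * (ωav : ℂ))) + (((-Real.exp (ν * t) - 1) / 2 : ℝ) : ℂ) * (1 + v₀))
    (hωm1 : ∀ t : ℝ, ωm1 t =
      ω₀ * Complex.exp (((ν : ℂ) + Complex.I * (ωav : ℂ)) * (t : ℂ)) / (Zp t) ^ 2)
    (hv : ∀ t : ℝ, v t = -Zm t / Zp t)
    (T : ℝ) (hT : 0 < T)
    (hZne : ∀ t ∈ Set.Ico (0 : ℝ) T, Zp t ≠ 0) :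
    (∀ t ∈ Set.Ico (0 : ℝ) T,
      HasDerivAt ωm1 ((Complex.I * (ωav : ℂ) - (ν : ℂ) * v t) * ωm1 t +
        2 * (ωm1 t) ^ 2 / (1 + v t)) t ∧
      HasDerivAt v (ωm1 t + ((ν : ℂ) / 2) * (1 - (v t) ^ 2)) t) ∧
    ωm1 0 = ω₀ ∧ v 0 = v₀ := by
  have hc : 1 + v₀ ≠ 0 := fun h => hv₀ (by linear_combination h)
  have hω : (ωav : ℂ) ≠ 0 := Complex.ofReal_ne_zero.mpr hωav
  have hI := Complex.I_ne_zero
  have hE : ∀ t : ℝ, HasDerivAt (fun s : ℝ => Complex.exp ((ν : ℂ) * (s : ℂ)))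
      (Complex.exp ((ν : ℂ) * (t : ℂ)) * ν) t := fun t => by
    simpa using ((Complex.ofRealCLM.hasDerivAt (x := t)).const_mul (ν : ℂ)).cexp
  have hW : ∀ t : ℝ, HasDerivAt (fun s : ℝ => Complex.exp (Complex.I * (ωav : ℂ) * (s : ℂ)))
      (Complex.exp (Complex.I * (ωav : ℂ) * (t : ℂ)) * (Complex.I * ωav)) t := fun t => by
    simpa using ((Complex.ofRealCLM.hasDerivAt (x := t)).const_mul (Complex.I * (ωav : ℂ))).cexp
  have hZp' : ∀ t : ℝ, HasDerivAt Zp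
      (-(ω₀ / (1 + v₀)) * Complex.exp (Complex.I * (ωav : ℂ) * (t : ℂ)) +
        ν / 2 * Complex.exp ((ν : ℂ) * (t : ℂ)) * (1 + v₀)) t := fun t => by
    have h := (((((hW t).sub_const 1).div_const (Complex.I * (ωav : ℂ))).const_mul
      (ω₀ / (1 + v₀))).const_sub 1).add
      ((((hE t).sub_const 1).div_const 2).mul_const (1 + v₀))
    refine (h.congr_deriv ?_).congr_of_eventuallyEq (.of_forall fun s => ?_)
    · field_simp
    · simp [hZp]
  have hZm_eq : ∀ t : ℝ, Zm t = Zp t - Complex.exp ((ν : ℂ) * (t : ℂ)) * (1 + v₀) := fun t => by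
    rw [hZm, hZp]
    push_cast
    ring
  have hωm1_eq : ωm1 = fun t : ℝ => ω₀ * (Complex.exp ((ν : ℂ) * (t : ℂ)) *
      Complex.exp (Complex.I * (ωav : ℂ) * (t : ℂ))) / (Zp t) ^ 2 := by
    funext t
    rw [hωm1, add_mul, Complex.exp_add]
  have hv_eq : v = fun t : ℝ =>
      -(Zp t - Complex.exp ((ν : ℂ) * (t : ℂ)) * (1 + v₀)) / Zp t := by
    funext t
    rw [hv, hZm_eq]
  have hZp0 : Zp 0 = 1 := by simp [hZp]
  refine ⟨fun t ht => ?_, by simp [hωm1, hZp0], by simp [hv_eq, hZp0]⟩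
  have hz := hZne t ht
  have hEne := Complex.exp_ne_zero ((ν : ℂ) * (t : ℂ))
  have hone : 1 + v t = Complex.exp ((ν : ℂ) * (t : ℂ)) * (1 + v₀) / Zp t := by
    rw [hv_eq]
    field_simp
    ring
  constructor
  · rw [hone, hωm1_eq, hv_eq]
    refine ((((hE t).mul (hW t)).const_mul ω₀).div ((hZp' t).pow 2)
      (pow_ne_zero 2 hz)).congr_deriv ?_
    simp only [Pi.mul_apply, Pi.pow_apply]
    field_simp
    ring
  · rw [hωm1_eq, hv_eq]
    refine ((((hZp' t).sub ((hE t).mul_const (1 + v₀))).neg).div (hZp' t) hz).congr_deriv ?_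
    simp only [Pi.neg_apply, Pi.sub_apply]
    field_simp
    ring
end

section
/- (Implicit solution of the a = 1/2, σ = 0 pole-dynamics system.) Let ν > 0, T > 0, and let ω, v : [0,T) → ℝ be differentiable with v(t) > 0 and v(t) ≠ 1 for all t ∈ [0,T), satisfying for all t ∈ [0,T): ω'(t) = ω(t)²·(1 - 2v(t)² + 5v(t)⁴)/(4v(t)²(1 - v(t)²)²) - ν·ω(t) and v'(t) = -ω(t)·(1 + v(t)²)/(4v(t)(1 - v(t)²)). Then for all t ∈ [0,T): (a) ω(t) = ω(0)·e^{-νt}·(v(0)/v(t))·((v(t)² - 1)/(v(0)² - 1))·((v(t)² + 1)/(v(0)² + 1))²; and (b) v(t)(v(t)² - 1)/(v(t)² + 1)² + arctan(v(t)) = v(0)(v(0)² - 1)/(v(0)² + 1)²·(1 + 2ω(0)(1 - e^{-νt})/(ν(v(0)² - 1)²)) + arctan(v(0)). -/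
/-- A function with vanishing derivative on `[0, T)` is constant there. -/
theorem eq_initial_of_hasDerivAt_zero {f : ℝ → ℝ} {T : ℝ}
    (hf : ∀ t ∈ Set.Ico (0 : ℝ) T, HasDerivAt f 0 t) :
    ∀ t ∈ Set.Ico (0 : ℝ) T, f t = f 0 := by
  intro t ht
  refine constant_of_has_deriv_right_zero (a := 0) (b := t) (fun s hs => ?_) (fun s hs => ?_) t
    ⟨ht.1, le_rfl⟩
  · exact (hf s ⟨hs.1, hs.2.trans_lt ht.2⟩).continuousAt.continuousWithinAt
  · exact (hf s ⟨hs.1, hs.2.trans ht.2⟩).hasDerivWithinAt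

/-- Implicit solution of the `a = 1/2`, `σ = 0` pole-dynamics system: any solution
`(ω, v)` of the real ODE system with `v > 0`, `v ≠ 1` on `[0,T)` satisfies the explicit
formula (a) for `ω` and the implicit identity (b) for `v`. -/
theorem implicit_solution_a_half_sigma0
    (ν T : ℝ) (hν : 0 < ν) (hT : 0 < T)
    (ω v : ℝ → ℝ)
    (hpos : ∀ t ∈ Set.Ico (0 : ℝ) T, 0 < v t)
    (hne1 : ∀ t ∈ Set.Ico (0 : ℝ) T, v t ≠ 1)
    (hω' : ∀ t ∈ Set.Ico (0 : ℝ) T, HasDerivAt ω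
      (ω t ^ 2 * (1 - 2 * v t ^ 2 + 5 * v t ^ 4) / (4 * v t ^ 2 * (1 - v t ^ 2) ^ 2)
        - ν * ω t) t)
    (hv' : ∀ t ∈ Set.Ico (0 : ℝ) T, HasDerivAt v
      (-(ω t * (1 + v t ^ 2) / (4 * v t * (1 - v t ^ 2)))) t) :
    ∀ t ∈ Set.Ico (0 : ℝ) T,
      ω t = ω 0 * Real.exp (-(ν * t)) * (v 0 / v t) * ((v t ^ 2 - 1) / (v 0 ^ 2 - 1)) *
        ((v t ^ 2 + 1) / (v 0 ^ 2 + 1)) ^ 2 ∧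
      v t * (v t ^ 2 - 1) / (v t ^ 2 + 1) ^ 2 + Real.arctan (v t) =
        v 0 * (v 0 ^ 2 - 1) / (v 0 ^ 2 + 1) ^ 2 *
          (1 + 2 * ω 0 * (1 - Real.exp (-(ν * t))) / (ν * (v 0 ^ 2 - 1) ^ 2)) +
        Real.arctan (v 0) := by
  have hne : ∀ t ∈ Set.Ico (0 : ℝ) T, v t ^ 2 - 1 ≠ 0 := by
    intro t ht h
    have h' : (v t - 1) * (v t + 1) = 0 := by linear_combination h
    rcases mul_eq_zero.mp h' with h1 | h1
    · exact hne1 t ht (by linarith)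
    · linarith [hpos t ht]
  have hexp : ∀ c t : ℝ, HasDerivAt (fun s => Real.exp (c * s)) (Real.exp (c * t) * c) t := by
    intro c t
    simpa using ((hasDerivAt_id t).const_mul c).exp
  have hconst := eq_initial_of_hasDerivAt_zero (T := T)
    (f := fun t => ω t * Real.exp (ν * t) * v t / ((v t ^ 2 - 1) * (v t ^ 2 + 1) ^ 2)) (by
      intro t ht
      have hv0 : v t ≠ 0 := (hpos t ht).ne'
      have h1 := hne t ht
      have h1' : 1 - v t ^ 2 ≠ 0 := fun h => h1 (by linarith)
      have h2 : v t ^ 2 + 1 ≠ 0 := by positivity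
      have hv := hv' t ht
      have key := (((hω' t ht).mul (hexp ν t)).mul hv).div
        (((hv.pow 2).sub_const 1).mul (((hv.pow 2).add_const 1).pow 2))
        (mul_ne_zero h1 (pow_ne_zero 2 h2))
      refine key.congr_deriv ?_
      simp only [Pi.mul_apply, Pi.pow_apply]
      rw [← neg_sub (v t ^ 2) 1]
      field_simp
      ring)
  have hω : ∀ t ∈ Set.Ico (0 : ℝ) T,
      ω t = ω 0 * Real.exp (-(ν * t)) * (v 0 / v t) * ((v t ^ 2 - 1) / (v 0 ^ 2 - 1)) *
        ((v t ^ 2 + 1) / (v 0 ^ 2 + 1)) ^ 2 := by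
    intro t ht
    have hv0 : v t ≠ 0 := (hpos t ht).ne'
    have h1 := hne t ht
    have h2 : v t ^ 2 + 1 ≠ 0 := by positivity
    have h3 := hne 0 ⟨le_rfl, hT⟩
    have h4 : v 0 ^ 2 + 1 ≠ 0 := by positivity
    have h := hconst t ht
    have he := Real.exp_ne_zero (ν * t)
    simp only [mul_zero, Real.exp_zero, mul_one] at h
    rw [Real.exp_neg]
    field_simp at h ⊢
    linear_combination h
  intro t ht
  refine ⟨hω t ht, ?_⟩
  have h3 := hne 0 ⟨le_rfl, hT⟩
  have h4 : v 0 ^ 2 + 1 ≠ 0 := by positivity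
  have hb := eq_initial_of_hasDerivAt_zero (T := T)
    (f := fun t => v t * (v t ^ 2 - 1) / (v t ^ 2 + 1) ^ 2 + Real.arctan (v t) +
      2 * (ω 0 * v 0 / ((v 0 ^ 2 - 1) * (v 0 ^ 2 + 1) ^ 2)) / ν * Real.exp (-ν * t)) (by
      intro t ht
      have hv0 : v t ≠ 0 := (hpos t ht).ne'
      have h1 := hne t ht
      have h2 : v t ^ 2 + 1 ≠ 0 := by positivity
      have hv := hv' t ht
      have key := (((hv.mul ((hv.pow 2).sub_const 1)).div (((hv.pow 2).add_const 1).pow 2)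
        (pow_ne_zero 2 h2)).add hv.arctan).add ((hexp (-ν) t).const_mul
          (2 * (ω 0 * v 0 / ((v 0 ^ 2 - 1) * (v 0 ^ 2 + 1) ^ 2)) / ν))
      refine key.congr_deriv ?_
      simp only [Pi.mul_apply, Pi.pow_apply]
      rw [← neg_sub (v t ^ 2) 1, hω t ht, add_comm 1 (v t ^ 2), neg_mul]
      field_simp
      ring) t ht
  simp only [mul_zero, Real.exp_zero, mul_one, neg_mul] at hb
  have hsplit : v 0 * (v 0 ^ 2 - 1) / (v 0 ^ 2 + 1) ^ 2 *
      (1 + 2 * ω 0 * (1 - Real.exp (-(ν * t))) / (ν * (v 0 ^ 2 - 1) ^ 2)) =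
      v 0 * (v 0 ^ 2 - 1) / (v 0 ^ 2 + 1) ^ 2 +
        2 * (ω 0 * v 0 / ((v 0 ^ 2 - 1) * (v 0 ^ 2 + 1) ^ 2)) / ν *
          (1 - Real.exp (-(ν * t))) := by
    field_simp
  rw [hsplit]
  linear_combination hb
end

section
/- (Invariant region / global existence, a = 1/2, σ = 0, phase-plane variables.) Let R(v) = (1/v - v)/2 for v > 0. Let T > 0 and let p, v : [0,T) → ℝ be differentiable with v(t) > 0 for all t ∈ [0,T), satisfying p'(t) = p(t)·(p(t)·R(v(t)) - 1) and v'(t) = -(p(t)/4)·(1 + v(t)²) for all t ∈ [0,T). If -1/v(0) ≤ p(0) ≤ v(0), then for all t ∈ [0,T): -1/v(t) ≤ p(t) ≤ v(t). -/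
/-- Invariant region / global existence for `a = 1/2`, `σ = 0` in phase-plane variables:
the region `{ (v,p) : v > 0, -1/v ≤ p ≤ v }` is invariant for the system
`p' = p(p R(v) - 1)`, `v' = -(p/4)(1+v²)` with `R(v) = (1/v - v)/2`. -/
theorem invariant_region_a_half_sigma0
    (T : ℝ) (hT : 0 < T) (p v : ℝ → ℝ)
    (hpos : ∀ t ∈ Set.Ico (0 : ℝ) T, 0 < v t)
    (hp' : ∀ t ∈ Set.Ico (0 : ℝ) T, HasDerivAt p
      (p t * (p t * ((1 / v t - v t) / 2) - 1)) t)
    (hv' : ∀ t ∈ Set.Ico (0 : ℝ) T, HasDerivAt v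
      (-(p t / 4) * (1 + v t ^ 2)) t)
    (h0l : -(1 / v 0) ≤ p 0) (h0u : p 0 ≤ v 0) :
    ∀ t ∈ Set.Ico (0 : ℝ) T, -(1 / v t) ≤ p t ∧ p t ≤ v t := by
  intro t ht
  have hsub : ∀ x ∈ Set.Icc 0 t, x ∈ Set.Ico (0 : ℝ) T := fun x hx => ⟨hx.1, hx.2.trans_lt ht.2⟩
  have hsub' : ∀ x ∈ Set.Ico 0 t, x ∈ Set.Ico (0 : ℝ) T := fun x hx => ⟨hx.1, hx.2.trans ht.2⟩
  have hw : ∀ x ∈ Set.Ico (0 : ℝ) T, HasDerivAt (fun s => -(1 / v s))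
      (-(p x / 4) * (1 + v x ^ 2) / v x ^ 2) x := fun x hx => by
    simp only [one_div]
    exact ((hv' x hx).fun_inv (hpos x hx).ne').fun_neg.congr_deriv (by ring)
  refine ⟨?_, ?_⟩
  · refine image_le_of_deriv_right_lt_deriv_boundary' (f := fun s => -(1 / v s))
      (fun x hx => (hw x (hsub x hx)).continuousAt.continuousWithinAt)
      (fun x hx => (hw x (hsub' x hx)).hasDerivWithinAt) h0l
      (fun x hx => (hp' x (hsub x hx)).continuousAt.continuousWithinAt)
      (fun x hx => (hp' x (hsub' x hx)).hasDerivWithinAt) ?_ (Set.right_mem_Icc.2 ht.1)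
    intro x hx hxp
    have hv := hpos x (hsub' x hx)
    rw [← hxp, ← sub_pos]
    have key : 0 < (1 + v x ^ 2) / (4 * v x ^ 3) := by positivity
    convert key using 1
    field_simp
    ring
  · refine image_le_of_deriv_right_lt_deriv_boundary'
      (fun x hx => (hp' x (hsub x hx)).continuousAt.continuousWithinAt)
      (fun x hx => (hp' x (hsub' x hx)).hasDerivWithinAt) h0u
      (fun x hx => (hv' x (hsub x hx)).continuousAt.continuousWithinAt)
      (fun x hx => (hv' x (hsub' x hx)).hasDerivWithinAt) ?_ (Set.right_mem_Icc.2 ht.1)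
    intro x hx hxp
    have hv := hpos x (hsub' x hx)
    rw [hxp, ← sub_pos]
    have key : 0 < v x * (1 + v x ^ 2) / 4 := by positivity
    convert key using 1
    field_simp
    ring
end

section
/- (Finite-time blowup, a = 1/2, σ = 1, phase-plane variables.) Let R(v) = (1/v - v)/2 and Q(v) = (1/v + v)/2 for v > 0, and set λ = 1/100 and μ = 1/5. Let T > 0 and let p, v : [0,T) → ℝ be differentiable with v(t) > 0 for all t ∈ [0,T), satisfying p'(t) = p(t)·(p(t)·R(v(t)) - Q(v(t))) and v'(t) = -(p(t)/4)·(1 + v(t)²) + (1/2)·(1 - v(t)²) for all t ∈ [0,T). Assume 0 < v(0) < √(1 - 2λ) and p(0) ≥ (Q(v(0)) + μ)/(R(v(0)) - λ). Then, with D = p(0)/(λ·p(0) + μ), one has p(t) > μ·D·e^{μt}/(1 - λ·D·e^{μt}) for all t ∈ (0,T), and T ≤ -(1/μ)·ln(λ·D). -/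
open Set

/-- A function with `f 0 > 0` satisfying a linear equation `f' = f * c`, with `c` continuous, stays
positive. -/
theorem pos_of_hasDerivAt_mul_self {T : ℝ} {f c : ℝ → ℝ}
    (hf : ∀ t ∈ Ico 0 T, HasDerivAt f (f t * c t) t) (hc : ContinuousOn c (Ico 0 T))
    (h0 : 0 < f 0) : ∀ t ∈ Ico 0 T, 0 < f t := by
  intro t ht
  have hsub : Icc 0 t ⊆ Ico 0 T := fun s hs => ⟨hs.1, hs.2.trans_lt ht.2⟩
  obtain ⟨K, hK⟩ := isCompact_Icc.exists_bound_of_continuousOn (hc.mono hsub)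
  have hB : ∀ x, HasDerivAt (fun s => -(f 0 * Real.exp (-(K + 1) * s)))
      (-(f 0 * (Real.exp (-(K + 1) * x) * (-(K + 1))))) x := fun x =>
    ((((hasDerivAt_id x).const_mul (-(K + 1))).exp).const_mul (f 0)).neg.congr_deriv (by simp)
  have key := image_le_of_deriv_right_lt_deriv_boundary (f := fun s => -f s)
    (f' := fun s => -(f s * c s)) (a := 0) (b := t)
    (fun s hs => (hf s (hsub hs)).neg.continuousAt.continuousWithinAt)
    (fun s hs => (hf s (hsub (Ico_subset_Icc_self hs))).neg.hasDerivWithinAt)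
    (by simp) hB ?_ (right_mem_Icc.2 ht.1)
  · exact (mul_pos h0 (Real.exp_pos _)).trans_le (neg_le_neg_iff.1 key)
  · intro x hx hfx
    have h1 := neg_le_of_abs_le (hK x (Ico_subset_Icc_self hx))
    have h2 : f x = f 0 * Real.exp (-(K + 1) * x) := neg_injective hfx
    have h3 : 0 < f 0 * Real.exp (-(K + 1) * x) := mul_pos h0 (Real.exp_pos _)
    rw [h2]
    nlinarith

/-- If `f 0 ≥ 0` and `f' > 0` at every zero of `f`, then `f > 0` at positive times. -/
theorem pos_of_deriv_pos_at_zeros {T : ℝ} {f f' : ℝ → ℝ}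
    (hf : ∀ t ∈ Ico 0 T, HasDerivAt f (f' t) t) (h0 : 0 ≤ f 0)
    (hz : ∀ t ∈ Ico 0 T, f t = 0 → 0 < f' t) : ∀ t ∈ Ioo 0 T, 0 < f t := by
  have hnn : ∀ t ∈ Ico 0 T, 0 ≤ f t := by
    intro t ht
    have hsub : Icc 0 t ⊆ Ico 0 T := fun s hs => ⟨hs.1, hs.2.trans_lt ht.2⟩
    have key := image_le_of_deriv_right_lt_deriv_boundary (f := fun s => -f s)
      (f' := fun s => -f' s) (B := fun _ => 0) (B' := fun _ => 0) (a := 0) (b := t)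
      (fun s hs => (hf s (hsub hs)).neg.continuousAt.continuousWithinAt)
      (fun s hs => (hf s (hsub (Ico_subset_Icc_self hs))).neg.hasDerivWithinAt)
      (by simpa using h0) (fun x => hasDerivAt_const x 0)
      (fun x hx hfx => by
        simpa using hz x (hsub (Ico_subset_Icc_self hx)) (neg_eq_zero.1 hfx))
      (right_mem_Icc.2 ht.1)
    simpa using key
  intro t ht
  have ht' := Ioo_subset_Ico_self ht
  refine (hnn t ht').lt_of_ne' fun h => ?_
  have hmin : IsLocalMin f t := by
    filter_upwards [Ioo_mem_nhds ht.1 ht.2] with s hs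
    exact h ▸ hnn s (Ioo_subset_Ico_self hs)
  exact (hz t ht' h).ne' (hmin.hasDerivAt_eq_zero (hf t ht'))

/-- On the boundary of the blowup region, the vector field points strictly inwards. -/
theorem inward_on_boundary {p v : ℝ} (hv : 0 < v) (hp : 0 < p)
    (h : p * (1 - v ^ 2 - (1 / 50) * v) - (1 + v ^ 2) - (2 / 5) * v = 0) :
    0 < p * (p * ((1 / v - v) / 2) - (1 / v + v) / 2) * (1 - v ^ 2 - (1 / 50) * v)
      - (-(p / 4) * (1 + v ^ 2) + (1 / 2) * (1 - v ^ 2)) *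
        (p * (2 * v + 1 / 50) + 2 * v + 2 / 5) := by
  have hA : 0 < 1 - v ^ 2 - (1 / 50) * v :=
    pos_of_mul_pos_right (a := p) (by nlinarith [sq_nonneg v]) hp.le
  have hv1 : v < 1 := by nlinarith
  have hR : p * ((1 / v - v) / 2) - (1 / v + v) / 2 = p / 100 + 1 / 5 := by
    field_simp
    linear_combination 500 * h
  have hpoly : 0 < 21 / 200 - 437 / 500 * v + 19583 / 25000 * v ^ 2 + 7399 / 1250 * v ^ 3
      + 15413 / 25000 * v ^ 4 - 443 / 500 * v ^ 5 + 19 / 200 * v ^ 6 := by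
    have h1 : 0 < 21 / 200 - 437 / 500 * v + 19583 / 25000 * v ^ 2 + 141 / 25 * v ^ 3 := by
      nlinarith [mul_nonneg hv.le (sq_nonneg (v - 9 / 50)), sq_nonneg (v - 9 / 50)]
    have h2 : 0 ≤ v ^ 3 * (7399 / 1250 - 141 / 25 + 15413 / 25000 * v - 443 / 500 * v ^ 2
        + 19 / 200 * v ^ 3) := by
      refine mul_nonneg (by positivity) ?_
      nlinarith [mul_pos hv (sub_pos.2 hv1), pow_pos hv 3]
    linarith
  rw [hR]
  have hpe : p = (1 + v ^ 2 + (2 / 5) * v) / (1 - v ^ 2 - (1 / 50) * v) := by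
    rw [eq_div_iff hA.ne']
    linarith
  refine (div_pos hpoly (pow_pos hA 2)).trans_eq ?_
  rw [hpe]
  obtain ⟨a, ha⟩ : ∃ a, a = 1 - v ^ 2 - (1 / 50) * v := ⟨_, rfl⟩
  rw [← ha] at hA ⊢
  field_simp
  rw [ha]
  ring

/-- Finite-time blowup for `a = 1/2`, `σ = 1` in phase-plane variables: with
`R(v) = (1/v - v)/2`, `Q(v) = (1/v + v)/2`, `λ = 1/100`, `μ = 1/5`, if the data satisfy
`0 < v(0) < √(1-2λ)` and `p(0) ≥ (Q(v(0))+μ)/(R(v(0))-λ)`, then with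
`D = p(0)/(λ p(0) + μ)` one has `p(t) > μ D e^{μt}/(1 - λ D e^{μt})` on `(0,T)` and
`T ≤ -(1/μ) ln(λ D)`. -/
theorem blowup_a_half_sigma1
    (T : ℝ) (hT : 0 < T) (p v : ℝ → ℝ)
    (hpos : ∀ t ∈ Set.Ico (0 : ℝ) T, 0 < v t)
    (hp' : ∀ t ∈ Set.Ico (0 : ℝ) T, HasDerivAt p
      (p t * (p t * ((1 / v t - v t) / 2) - (1 / v t + v t) / 2)) t)
    (hv' : ∀ t ∈ Set.Ico (0 : ℝ) T, HasDerivAt v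
      (-(p t / 4) * (1 + v t ^ 2) + (1 / 2) * (1 - v t ^ 2)) t)
    (hv0 : 0 < v 0) (hv0' : v 0 < Real.sqrt (1 - 2 * (1 / 100)))
    (hp0 : ((1 / v 0 + v 0) / 2 + 1 / 5) / ((1 / v 0 - v 0) / 2 - 1 / 100) ≤ p 0) :
    (∀ t ∈ Set.Ioo (0 : ℝ) T,
      (1 / 5) * (p 0 / ((1 / 100) * p 0 + 1 / 5)) * Real.exp ((1 / 5) * t) /
        (1 - (1 / 100) * (p 0 / ((1 / 100) * p 0 + 1 / 5)) * Real.exp ((1 / 5) * t))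
        < p t) ∧
    T ≤ -(1 / (1 / 5)) * Real.log ((1 / 100) * (p 0 / ((1 / 100) * p 0 + 1 / 5))) := by
  have hpc : ∀ t ∈ Ico (0 : ℝ) T, ContinuousWithinAt p (Ico 0 T) t :=
    fun t ht => (hp' t ht).continuousAt.continuousWithinAt
  have hvc : ∀ t ∈ Ico (0 : ℝ) T, ContinuousWithinAt v (Ico 0 T) t :=
    fun t ht => (hv' t ht).continuousAt.continuousWithinAt
  have hsq : v 0 ^ 2 < 1 - 2 * (1 / 100) := (Real.lt_sqrt hv0.le).1 hv0'
  have hv1 : v 0 < 1 := by nlinarith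
  have hden : 0 < (1 / v 0 - v 0) / 2 - 1 / 100 := by
    have : (1 / v 0 - v 0) / 2 - 1 / 100 = (1 - v 0 ^ 2 - v 0 / 50) / (2 * v 0) := by
      field_simp
      ring
    rw [this]
    exact div_pos (by linarith) (by linarith)
  have hp00 : 0 < p 0 := lt_of_lt_of_le (div_pos (by positivity) hden) hp0
  have hp : ∀ t ∈ Ico (0 : ℝ) T, 0 < p t := by
    refine pos_of_hasDerivAt_mul_self hp' (fun t ht => ?_) hp00
    have hinv : ContinuousWithinAt (fun s => 1 / v s) (Ico 0 T) t :=
      continuousWithinAt_const.div (hvc t ht) (hpos t ht).ne'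
    exact ((hpc t ht).mul ((hinv.sub (hvc t ht)).div_const 2)).sub
      ((hinv.add (hvc t ht)).div_const 2)
  -- The blowup region is `{g ≥ 0}`.
  have hg : ∀ t ∈ Ioo (0 : ℝ) T,
      0 < p t * (1 - v t ^ 2 - (1 / 50) * v t) - (1 + v t ^ 2) - (2 / 5) * v t := by
    refine pos_of_deriv_pos_at_zeros
      (f := fun t => p t * (1 - v t ^ 2 - (1 / 50) * v t) - (1 + v t ^ 2) - (2 / 5) * v t)
      (f' := fun t => p t * (p t * ((1 / v t - v t) / 2) - (1 / v t + v t) / 2) *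
          (1 - v t ^ 2 - (1 / 50) * v t)
        - (-(p t / 4) * (1 + v t ^ 2) + (1 / 2) * (1 - v t ^ 2)) *
          (p t * (2 * v t + 1 / 50) + 2 * v t + 2 / 5)) (fun t ht => ?_) ?_
      (fun t ht h => inward_on_boundary (hpos t ht) (hp t ht) h)
    · have hv2 := (hv' t ht).pow 2
      refine ((((hp' t ht).mul ((hv2.const_sub 1).sub ((hv' t ht).const_mul (1 / 50)))).sub
        (hv2.const_add 1)).sub ((hv' t ht).const_mul (2 / 5))).congr_deriv ?_
      simp
      ring
    · rw [div_le_iff₀ hden] at hp0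
      have h : p 0 * (1 - v 0 ^ 2 - (1 / 50) * v 0) - (1 + v 0 ^ 2) - (2 / 5) * v 0 =
          2 * v 0 * (p 0 * ((1 / v 0 - v 0) / 2 - 1 / 100) -
            ((1 / v 0 + v 0) / 2 + 1 / 5)) := by
        field_simp
        ring
      change 0 ≤ p 0 * (1 - v 0 ^ 2 - (1 / 50) * v 0) - (1 + v 0 ^ 2) - (2 / 5) * v 0
      rw [h]
      exact mul_nonneg (by linarith) (by linarith)
  set D := p 0 / ((1 / 100) * p 0 + 1 / 5) with hD
  have hDpos : 0 < D := div_pos hp00 (by linarith)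
  -- `p / (λ p + μ)` grows strictly faster than `exp (μ t)`.
  have hw' : ∀ t ∈ Ico (0 : ℝ) T, HasDerivAt
      (fun s => p s / ((1 / 100) * p s + 1 / 5) * Real.exp (-(1 / 5) * s))
      ((1 / 5) * p t * (p t * ((1 / v t - v t) / 2) - (1 / v t + v t) / 2 -
        ((1 / 100) * p t + 1 / 5)) / ((1 / 100) * p t + 1 / 5) ^ 2 *
          Real.exp (-(1 / 5) * t)) t := fun t ht => by
    have hne : (1 / 100) * p t + 1 / 5 ≠ 0 := by linarith [hp t ht]
    refine (((hp' t ht).div (((hp' t ht).const_mul (1 / 100)).add_const (1 / 5)) hne).mul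
      (((hasDerivAt_id t).const_mul (-(1 / 5))).exp)).congr_deriv ?_
    simp only [id, Pi.div_apply]
    generalize p t * ((1 / v t - v t) / 2) - (1 / v t + v t) / 2 = r
    generalize Real.exp (-(1 / 5) * t) = e
    field_simp
    ring
  have hmono : StrictMonoOn
      (fun s => p s / ((1 / 100) * p s + 1 / 5) * Real.exp (-(1 / 5) * s)) (Ico 0 T) := by
    refine strictMonoOn_of_deriv_pos (convex_Ico 0 T)
      (fun t ht => (hw' t ht).continuousAt.continuousWithinAt) fun t ht => ?_
    rw [interior_Ico] at ht
    have ht' := Ioo_subset_Ico_self ht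
    have hpt := hp t ht'
    have hvt := hpos t ht'
    rw [(hw' t ht').deriv]
    have h : p t * ((1 / v t - v t) / 2) - (1 / v t + v t) / 2 - ((1 / 100) * p t + 1 / 5) =
        (p t * (1 - v t ^ 2 - (1 / 50) * v t) - (1 + v t ^ 2) - (2 / 5) * v t) / (2 * v t) := by
      field_simp
      ring
    rw [h]
    have := hg t ht
    positivity
  have hgrow : ∀ t ∈ Ioo (0 : ℝ) T,
      D * Real.exp ((1 / 5) * t) * ((1 / 100) * p t + 1 / 5) < p t := fun t ht => by
    have hpt := hp t (Ioo_subset_Ico_self ht)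
    have h := hmono ⟨le_rfl, hT⟩ (Ioo_subset_Ico_self ht) ht.1
    simp only [mul_zero, Real.exp_zero, mul_one, neg_mul, Real.exp_neg] at h
    rw [← hD, ← div_eq_mul_inv, lt_div_iff₀ (Real.exp_pos _)] at h
    exact (lt_div_iff₀ (by linarith)).1 h
  have hlt : ∀ t ∈ Ioo (0 : ℝ) T, (1 / 100) * D * Real.exp ((1 / 5) * t) < 1 := fun t ht => by
    have hE : 0 < D * Real.exp ((1 / 5) * t) := mul_pos hDpos (Real.exp_pos _)
    have hpt := hp t (Ioo_subset_Ico_self ht)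
    nlinarith [hgrow t ht]
  refine ⟨fun t ht => ?_, ?_⟩
  · rw [div_lt_iff₀ (sub_pos.2 (hlt t ht))]
    linarith [hgrow t ht]
  · by_contra! hcon
    have hc0 : 0 < (1 / 100) * D := by positivity
    have hc1 : (1 / 100) * D < 1 := by
      rw [hD, ← mul_div_assoc, div_lt_one (by linarith)]
      linarith
    have h := hlt _ ⟨by linarith [Real.log_neg hc0 hc1], hcon⟩
    rw [show 1 / 5 * (-(1 / (1 / 5)) * Real.log (1 / 100 * D)) = -Real.log (1 / 100 * D) by ring,
      Real.exp_neg, Real.exp_log hc0, mul_inv_cancel₀ hc0.ne'] at h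
    exact lt_irrefl _ h
end

section
/- (Finite-time blowup, a = 1/2, σ = 0, phase-plane variables.) Let R(v) = (1/v - v)/2 for v > 0. Let T > 0 and let p, v : [0,T) → ℝ be differentiable with v(t) > 0 for all t ∈ [0,T), satisfying p'(t) = p(t)·(p(t)·R(v(t)) - 1) and v'(t) = -(p(t)/4)·(1 + v(t)²) for all t ∈ [0,T). Assume 0 < v(0) < 1, let ρ satisfy 0 < ρ < R(v(0)), and assume p(0) > 1/(R(v(0)) - ρ). Then for all t ∈ (0,T): v(t) < v(0) and p(t) ≥ p(0)/(1 - ρ·p(0)·t); consequently T ≤ 1/(p(0)·ρ). -/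
open Set Filter Topology

/-- A function with positive derivative at `x` is larger immediately to the right of `x`. -/
theorem HasDerivAt.eventually_lt_nhdsGT {f : ℝ → ℝ} {f' x : ℝ} (hf : HasDerivAt f f' x)
    (hf' : 0 < f') : ∀ᶠ y in 𝓝[>] x, f x < f y := by
  have hslope : Tendsto (slope f x) (𝓝[>] x) (𝓝 f') :=
    hf.tendsto_slope.mono_left (nhdsWithin_mono x fun y hy => ne_of_gt hy)
  filter_upwards [hslope.eventually (lt_mem_nhds hf'), self_mem_nhdsWithin] with y hy hxy
  rw [slope_def_field, div_pos_iff_of_pos_right (sub_pos.2 hxy)] at hy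
  exact sub_pos.1 hy

/-- If the derivatives of `f` and `g` are positive whenever `f` and `g` are at least their initial
values, then both stay above their initial values. -/
theorem initial_le_of_hasDerivAt_pos {f g f' g' : ℝ → ℝ} {b : ℝ}
    (hf : ∀ t ∈ Icc 0 b, HasDerivAt f (f' t) t) (hg : ∀ t ∈ Icc 0 b, HasDerivAt g (g' t) t)
    (hpos : ∀ t ∈ Icc 0 b, f 0 ≤ f t → g 0 ≤ g t → 0 < f' t ∧ 0 < g' t) :
    ∀ t ∈ Icc 0 b, f 0 ≤ f t ∧ g 0 ≤ g t := by
  have hfc : ContinuousOn f (Icc 0 b) := fun t ht => (hf t ht).continuousAt.continuousWithinAt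
  have hgc : ContinuousOn g (Icc 0 b) := fun t ht => (hg t ht).continuousAt.continuousWithinAt
  have hclosed : IsClosed ({t | f 0 ≤ f t ∧ g 0 ≤ g t} ∩ Icc 0 b) := by
    have h := (hfc.preimage_isClosed_of_isClosed isClosed_Icc (isClosed_Ici (a := f 0))).inter
      (hgc.preimage_isClosed_of_isClosed isClosed_Icc (isClosed_Ici (a := g 0)))
    convert h using 1
    ext t
    simp only [mem_inter_iff, mem_ofPred_eq, mem_preimage, mem_Ici]
    tauto
  refine hclosed.Icc_subset_of_forall_exists_gt ⟨le_rfl, le_rfl⟩ ?_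
  rintro x ⟨⟨hfx, hgx⟩, hx⟩ y hy
  have hx' := Ico_subset_Icc_self hx
  obtain ⟨hf', hg'⟩ := hpos x hx' hfx hgx
  obtain ⟨z, hfz, hgz, hz⟩ := (((hf x hx').eventually_lt_nhdsGT hf').and
    (((hg x hx').eventually_lt_nhdsGT hg').and (Ioc_mem_nhdsGT hy))).exists
  exact ⟨z, ⟨hfx.trans hfz.le, hgx.trans hgz.le⟩, hz⟩

/-- The Riccati inequality `p' ≥ ρ p²` forces `1 / p` to decrease at rate at least `ρ`. -/
theorem inv_le_of_mul_sq_le_hasDerivAt {p p' : ℝ → ℝ} {ρ t : ℝ} (ht : 0 ≤ t)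
    (hp : ∀ s ∈ Icc 0 t, HasDerivAt p (p' s) s) (hpos : ∀ s ∈ Icc 0 t, 0 < p s)
    (hle : ∀ s ∈ Icc 0 t, ρ * p s ^ 2 ≤ p' s) : (p t)⁻¹ ≤ (p 0)⁻¹ - ρ * t := by
  have hd : ∀ s ∈ Icc 0 t,
      HasDerivAt (fun s => (p s)⁻¹ + ρ * s) (-p' s / p s ^ 2 + ρ * 1) s := fun s hs =>
    ((hp s hs).fun_inv (hpos s hs).ne').add ((hasDerivAt_id s).const_mul ρ)
  have hanti : AntitoneOn (fun s => (p s)⁻¹ + ρ * s) (Icc 0 t) := by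
    refine antitoneOn_of_hasDerivWithinAt_nonpos (convex_Icc 0 t)
      (fun s hs => (hd s hs).continuousAt.continuousWithinAt)
      (fun s hs => (hd s (interior_subset hs)).hasDerivWithinAt) fun s hs => ?_
    have hs' := interior_subset hs
    have := (le_div_iff₀ (pow_pos (hpos s hs') 2)).2 (hle s hs')
    rw [neg_div]
    linarith
  have := hanti (left_mem_Icc.2 ht) (right_mem_Icc.2 ht) ht
  simp only [mul_zero, add_zero] at this
  linarith

/-- Finite-time blowup for `a = 1/2`, `σ = 0` in phase-plane variables: with
`R(v) = (1/v - v)/2`, if `0 < v(0) < 1`, `0 < ρ < R(v(0))` and `p(0) > 1/(R(v(0)) - ρ)`,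
then `v(t) < v(0)` and `p(t) ≥ p(0)/(1 - ρ p(0) t)` for `t ∈ (0,T)`, and
consequently `T ≤ 1/(p(0) ρ)`. -/
theorem blowup_a_half_sigma0
    (T : ℝ) (hT : 0 < T) (p v : ℝ → ℝ)
    (hpos : ∀ t ∈ Set.Ico (0 : ℝ) T, 0 < v t)
    (hp' : ∀ t ∈ Set.Ico (0 : ℝ) T, HasDerivAt p
      (p t * (p t * ((1 / v t - v t) / 2) - 1)) t)
    (hv' : ∀ t ∈ Set.Ico (0 : ℝ) T, HasDerivAt v
      (-(p t / 4) * (1 + v t ^ 2)) t)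
    (hv0 : v 0 < 1)
    (ρ : ℝ) (hρ : 0 < ρ) (hρ' : ρ < (1 / v 0 - v 0) / 2)
    (hp0 : 1 / ((1 / v 0 - v 0) / 2 - ρ) < p 0) :
    (∀ t ∈ Set.Ioo (0 : ℝ) T, v t < v 0 ∧ p 0 / (1 - ρ * p 0 * t) ≤ p t) ∧
    T ≤ 1 / (p 0 * ρ) := by
  have hgap : 0 < (1 / v 0 - v 0) / 2 - ρ := sub_pos.2 hρ'
  have hp0_pos : 0 < p 0 := (one_div_pos.2 hgap).trans hp0
  have hp0_gap : 1 < p 0 * ((1 / v 0 - v 0) / 2 - ρ) := (div_lt_iff₀ hgap).1 hp0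
  have hriccati : ∀ t ∈ Ico 0 T, p 0 ≤ p t → v t ≤ v 0 →
      ρ * p t ^ 2 ≤ p t * (p t * ((1 / v t - v t) / 2) - 1) := by
    intro t ht hpt hvt
    have hR : (1 / v 0 - v 0) / 2 ≤ (1 / v t - v t) / 2 := by
      have := one_div_le_one_div_of_le (hpos t ht) hvt
      linarith
    have hpt_pos : 0 < p t := hp0_pos.trans_le hpt
    have h₁ := mul_le_mul_of_nonneg_right hpt hgap.le
    have h₂ := mul_le_mul_of_nonneg_left hR hpt_pos.le
    have h₃ : ρ * p t ≤ p t * ((1 / v t - v t) / 2) - 1 := by linarith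
    calc ρ * p t ^ 2 = p t * (ρ * p t) := by ring
      _ ≤ _ := mul_le_mul_of_nonneg_left h₃ hpt_pos.le
  have hbound : ∀ t ∈ Ico 0 T, p 0 ≤ p t ∧ v t ≤ v 0 := by
    intro t ht
    have hsub : Icc 0 t ⊆ Ico 0 T := fun s hs => ⟨hs.1, hs.2.trans_lt ht.2⟩
    have h := initial_le_of_hasDerivAt_pos (g := fun s => -v s) (fun s hs => hp' s (hsub hs))
      (fun s hs => (hv' s (hsub hs)).fun_neg) (fun s hs hps hvs => by
        have hps_pos : 0 < p s := hp0_pos.trans_le hps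
        refine ⟨lt_of_lt_of_le (by positivity)
          (hriccati s (hsub hs) hps (neg_le_neg_iff.1 hvs)), ?_⟩
        rw [neg_mul, neg_neg]
        positivity) t (right_mem_Icc.2 ht.1)
    exact ⟨h.1, neg_le_neg_iff.1 h.2⟩
  have hp_pos : ∀ t ∈ Ico 0 T, 0 < p t := fun t ht => hp0_pos.trans_le (hbound t ht).1
  have hinv : ∀ t ∈ Ico 0 T, (p t)⁻¹ ≤ (p 0)⁻¹ - ρ * t := by
    intro t ht
    have hsub : Icc 0 t ⊆ Ico 0 T := fun s hs => ⟨hs.1, hs.2.trans_lt ht.2⟩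
    exact inv_le_of_mul_sq_le_hasDerivAt ht.1 (fun s hs => hp' s (hsub hs))
      (fun s hs => hp_pos s (hsub hs)) fun s hs =>
        hriccati s (hsub hs) (hbound s (hsub hs)).1 (hbound s (hsub hs)).2
  have hv_anti : StrictAntiOn v (Ico 0 T) := by
    refine strictAntiOn_of_hasDerivWithinAt_neg (convex_Ico 0 T)
      (fun s hs => (hv' s hs).continuousAt.continuousWithinAt)
      (fun s hs => (hv' s (interior_subset hs)).hasDerivWithinAt) fun s hs => ?_
    have := hp_pos s (interior_subset hs)
    rw [neg_mul, neg_lt_zero]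
    positivity
  refine ⟨fun t ht => ⟨hv_anti (left_mem_Ico.2 hT) (Ioo_subset_Ico_self ht) ht.1, ?_⟩, ?_⟩
  · have ht' := Ioo_subset_Ico_self ht
    have h := inv_anti₀ (inv_pos.2 (hp_pos t ht')) (hinv t ht')
    rw [inv_inv] at h
    have hdiv : p 0 / (1 - ρ * p 0 * t) = ((p 0)⁻¹ - ρ * t)⁻¹ := by
      rw [← inv_div]
      congr 1
      field_simp
    rwa [hdiv]
  · by_contra! hlt
    have ht : 1 / (p 0 * ρ) ∈ Ico 0 T := ⟨by positivity, hlt⟩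
    have h := hinv _ ht
    have hzero : (p 0)⁻¹ - ρ * (1 / (p 0 * ρ)) = 0 := by
      field_simp
      ring
    rw [hzero] at h
    exact h.not_gt (inv_pos.2 (hp_pos _ ht))
end
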